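/- Let N ≥ 3 and let Ω ⊂ ℝ^N be a smooth domain with 0 ∈ ∂Ω. Assume N − 1 < c ≤ μ(Ω). Let p ≥ p_{S_+^{N−1}} := 1 + 2/((N−2)/2 − √(N²/4 − c)). If u ∈ L^p_loc(Ω) is nonnegative, c|x|^{−2}u ∈ L¹_loc(Ω), and ∫ u(−Δφ − c|x|^{−2}φ) dx ≥ ∫ u^p φ dx for every nonnegative φ ∈ C_c^∞(Ω), then u ≡ 0 almost everywhere in Ω. -/

import Mathlib

open MeasureTheory Metric Filter
open scoped Topology ENNReal NNReal RealInnerProductSpace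

noncomputable section

/-- `ℝ^N` as a Euclidean space. -/
abbrev Euc (N : ℕ) : Type := EuclideanSpace ℝ (Fin N)

/-- `φ ∈ C_c^∞(Ω)`: smooth functions with compact support contained in `Ω`. -/
def IsTestFun {N : ℕ} (Ω : Set (Euc N)) (φ : Euc N → ℝ) : Prop :=
  ContDiff ℝ (⊤ : ℕ∞) φ ∧ HasCompactSupport φ ∧ tsupport φ ⊆ Ω

/-- The classical Laplacian of `φ` at `x`: the sum of the pure second partial derivatives. -/
def lap {N : ℕ} (φ : Euc N → ℝ) (x : Euc N) : ℝ :=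
  ∑ i : Fin N, iteratedFDeriv ℝ 2 φ x ![EuclideanSpace.single i 1, EuclideanSpace.single i 1]

/-- The best constant `μ(Ω)` in the Hardy inequality on `Ω` with the weight `|x|⁻²`. -/
def hardyConst {N : ℕ} (Ω : Set (Euc N)) : ℝ :=
  sInf {t : ℝ | ∃ φ : Euc N → ℝ, IsTestFun Ω φ ∧ φ ≠ 0 ∧
    t = (∫ x in Ω, ‖gradient φ x‖ ^ 2) / (∫ x in Ω, ‖x‖ ^ (-2 : ℝ) * φ x ^ 2)}

/-- A smooth domain of `ℝ^N`: a nonempty open connected set whose boundary is, near each of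
its points, the zero set of a smooth function with non-vanishing differential, the domain
being the corresponding sublevel set. -/
def IsSmoothDomain {N : ℕ} (Ω : Set (Euc N)) : Prop :=
  IsOpen Ω ∧ Ω.Nonempty ∧ IsConnected Ω ∧
    ∀ x ∈ frontier Ω, ∃ (U : Set (Euc N)) (f : Euc N → ℝ),
      IsOpen U ∧ x ∈ U ∧ ContDiff ℝ (⊤ : ℕ∞) f ∧ (∀ y ∈ U, fderiv ℝ f y ≠ 0) ∧
      Ω ∩ U = {y ∈ U | f y < 0} ∧ frontier Ω ∩ U = {y ∈ U | f y = 0}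

lemma lap_of_form {N : ℕ} (φ a b : Euc N → ℝ) (x x0 e : Euc N) (a1 a2 b1 b2 : ℝ)
    (h : ∀ᶠ y in 𝓝 x, HasFDerivAt φ (a y • innerSL ℝ (y - x0) + b y • innerSL ℝ e) y)
    (ha : HasFDerivAt a (a1 • innerSL ℝ (x - x0) + a2 • innerSL ℝ e) x)
    (hb : HasFDerivAt b (b1 • innerSL ℝ (x - x0) + b2 • innerSL ℝ e) x) :
    lap φ x = a1 * ‖x - x0‖ ^ 2 + (a2 + b1) * ⟪x - x0, e⟫ + N * a x + b2 * ‖e‖ ^ 2 := by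
  have hf : fderiv ℝ φ =ᶠ[𝓝 x] fun y => a y • innerSL ℝ (y - x0) + b y • innerSL ℝ e := by
    filter_upwards [h] with y hy using hy.fderiv
  have hin : HasFDerivAt (fun y : Euc N => innerSL ℝ (y - x0)) (innerSL ℝ : Euc N →L[ℝ] Euc N →L[ℝ] ℝ) x := by
    have := ((innerSL ℝ : Euc N →L[ℝ] Euc N →L[ℝ] ℝ).hasFDerivAt (x := x - x0)).comp x
      ((hasFDerivAt_id x).sub_const x0)
    simp only [ContinuousLinearMap.comp_id] at this
    exact this
  have hF := (ha.smul hin).add (hb.smul (hasFDerivAt_const (innerSL ℝ e) x))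
  have hF2 := hf.fderiv_eq.trans hF.fderiv
  unfold lap
  have key : ∀ i : Fin N, iteratedFDeriv ℝ 2 φ x ![EuclideanSpace.single i 1, EuclideanSpace.single i 1]
      = a1 * ((x - x0) i * (x - x0) i) + (a2 + b1) * ((x - x0) i * e i) + a x + b2 * (e i * e i) := by
    intro i
    have hii : (innerSL ℝ (EuclideanSpace.single i (1:ℝ) : Euc N)) (EuclideanSpace.single i (1:ℝ)) = 1 := by
      rw [innerSL_apply_apply]; simp
    rw [iteratedFDeriv_two_apply, hF2]
    simp [EuclideanSpace.inner_single_right, hii]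
    ring
  simp only [key, Finset.sum_add_distrib, ← Finset.mul_sum]
  have n1 : ‖x - x0‖ ^ 2 = ∑ i, (x - x0) i * (x - x0) i := by
    rw [EuclideanSpace.norm_sq_eq]; simp [sq]
  have n2 : ‖e‖ ^ 2 = ∑ i, e i * e i := by
    rw [EuclideanSpace.norm_sq_eq]; simp [sq]
  have n3 : ⟪x - x0, e⟫ = ∑ i, (x - x0) i * e i := by
    rw [PiLp.inner_apply]; simp [mul_comm]
  rw [n1, n2, n3]
  simp


/-- logarithmic variable -/
def tauv {N : ℕ} (y : Euc N) : ℝ := -(1/2) * Real.log (‖y‖ ^ 2)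

/-- inverted height -/
def zetv {N : ℕ} (e y : Euc N) : ℝ := ⟪y, e⟫ * (‖y‖ ^ 2)⁻¹

lemma hasFDerivAt_normsq {N : ℕ} (y : Euc N) :
    HasFDerivAt (fun y : Euc N => ‖y‖ ^ 2) ((2:ℝ) • innerSL ℝ y) y := by
  have := (hasStrictFDerivAt_norm_sq y).hasFDerivAt
  refine this.congr_fderiv ?_
  ext v; simp [two_smul]

lemma hasFDerivAt_tauv {N : ℕ} (y : Euc N) (hy : y ≠ 0) :
    HasFDerivAt (tauv : Euc N → ℝ) ((-(‖y‖ ^ 2)⁻¹) • innerSL ℝ y) y := by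
  have h0 : ‖y‖ ^ 2 ≠ 0 := by positivity
  have := ((hasFDerivAt_normsq y).log h0).const_mul (-(1/2))
  refine HasFDerivAt.congr_fderiv this ?_
  rw [smul_smul, smul_smul]; congr 1; field_simp

lemma hasFDerivAt_inv_normsq {N : ℕ} (y : Euc N) (hy : y ≠ 0) :
    HasFDerivAt (fun y : Euc N => (‖y‖ ^ 2)⁻¹) ((-2 * ((‖y‖ ^ 2)⁻¹) ^ 2) • innerSL ℝ y) y := by
  have h0 : ‖y‖ ^ 2 ≠ 0 := by positivity
  have := (hasDerivAt_inv h0).comp_hasFDerivAt y (hasFDerivAt_normsq y)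
  refine HasFDerivAt.congr_fderiv this ?_
  rw [smul_smul]; congr 1; field_simp

lemma hasFDerivAt_zetv {N : ℕ} (e y : Euc N) (hy : y ≠ 0) :
    HasFDerivAt (zetv e) ((-2 * zetv e y * (‖y‖ ^ 2)⁻¹) • innerSL ℝ y
      + ((‖y‖ ^ 2)⁻¹) • innerSL ℝ e) y := by
  have h1 : HasFDerivAt (fun y : Euc N => ⟪y, e⟫) (innerSL ℝ e) y := by
    have := (innerSL ℝ e).hasFDerivAt (x := y)
    refine this.congr_of_eventuallyEq (Eventually.of_forall fun v => ?_)
    simp [real_inner_comm]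
  have := h1.mul (hasFDerivAt_inv_normsq y hy)
  refine HasFDerivAt.congr_fderiv this ?_
  rw [smul_smul]; congr 2
  simp only [zetv]; ring

lemma lap_GG {N : ℕ} (e : Euc N) (he : ‖e‖ = 1) (G G1 G2 g g1 g2 : ℝ → ℝ)
    (hG : ∀ t, HasDerivAt G (G1 t) t) (hG1 : ∀ t, HasDerivAt G1 (G2 t) t)
    (hg : ∀ t, HasDerivAt g (g1 t) t) (hg1 : ∀ t, HasDerivAt g1 (g2 t) t)
    (x : Euc N) (hx : x ≠ 0) :
    lap (fun y => G (tauv y) * g (zetv e y)) x =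
      (‖x‖ ^ 2)⁻¹ * (G2 (tauv x) * g (zetv e x) - (N - 2) * G1 (tauv x) * g (zetv e x)
        + 2 * G1 (tauv x) * (zetv e x * g1 (zetv e x))
        + G (tauv x) * ((‖x‖ ^ 2)⁻¹ * g2 (zetv e x) - (2 * N - 4) * (zetv e x * g1 (zetv e x)))) := by
  set r := (‖x‖ ^ 2)⁻¹ with hr
  set T := tauv x with hT
  set Z := zetv e x with hZ
  have h0 : ‖x‖ ^ 2 ≠ 0 := by positivity
  have hGf : ∀ y : Euc N, y ≠ 0 → HasFDerivAt (fun y => G (tauv y)) (G1 (tauv y) • ((-(‖y‖ ^ 2)⁻¹) • innerSL ℝ y)) y :=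
    fun y hy => (hG _).comp_hasFDerivAt y (hasFDerivAt_tauv y hy)
  have hG1f : ∀ y : Euc N, y ≠ 0 → HasFDerivAt (fun y => G1 (tauv y)) (G2 (tauv y) • ((-(‖y‖ ^ 2)⁻¹) • innerSL ℝ y)) y :=
    fun y hy => (hG1 _).comp_hasFDerivAt y (hasFDerivAt_tauv y hy)
  have hgf : ∀ y : Euc N, y ≠ 0 → HasFDerivAt (fun y => g (zetv e y)) (g1 (zetv e y) • ((-2 * zetv e y * (‖y‖ ^ 2)⁻¹) • innerSL ℝ y
      + ((‖y‖ ^ 2)⁻¹) • innerSL ℝ e)) y :=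
    fun y hy => (hg _).comp_hasFDerivAt y (hasFDerivAt_zetv e y hy)
  have hg1f : ∀ y : Euc N, y ≠ 0 → HasFDerivAt (fun y => g1 (zetv e y)) (g2 (zetv e y) • ((-2 * zetv e y * (‖y‖ ^ 2)⁻¹) • innerSL ℝ y
      + ((‖y‖ ^ 2)⁻¹) • innerSL ℝ e)) y :=
    fun y hy => (hg1 _).comp_hasFDerivAt y (hasFDerivAt_zetv e y hy)
  have hi := hasFDerivAt_inv_normsq x hx
  have hz := hasFDerivAt_zetv e x hx
  have A := lap_of_form (fun y => G (tauv y) * g (zetv e y))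
    (fun y => -(‖y‖ ^ 2)⁻¹ * (G1 (tauv y) * g (zetv e y) + 2 * (G (tauv y) * (g1 (zetv e y) * zetv e y))))
    (fun y => (‖y‖ ^ 2)⁻¹ * (G (tauv y) * g1 (zetv e y))) x 0 e
    (2 * r ^ 2 * (G1 T * g Z + 2 * (G T * (g1 Z * Z)))
      - r * (-r * G2 T * g Z - 2 * r * Z * g1 Z * G1 T + 2 * (-r * G1 T * g1 Z * Z
        + G T * (-2 * r * Z * (g2 Z * Z + g1 Z)))))
    (-r * (G1 T * g1 Z * r + 2 * (G T * r * (g2 Z * Z + g1 Z))))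
    (-2 * r ^ 2 * (G T * g1 Z) + r * (-r * G1 T * g1 Z - 2 * r * Z * g2 Z * G T))
    (r * (r * G T * g2 Z))
    ?_ ?_ ?_
  · have hin : ⟪x, e⟫ = Z * ‖x‖ ^ 2 := by
      rw [hZ, zetv]; field_simp
    have hrr : r * ‖x‖ ^ 2 = 1 := by rw [hr]; field_simp
    have hr2 : ‖x‖ ^ 2 = r⁻¹ := by rw [hr, inv_inv]
    have hr0 : r ≠ 0 := by rw [hr]; positivity
    rw [A, sub_zero, hin, he, hr2]
    simp only [Pi.neg_apply, Pi.mul_apply, ← hr, ← hT, ← hZ]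
    field_simp
    ring
  · filter_upwards [isOpen_ne.mem_nhds hx] with y hy
    refine HasFDerivAt.congr_fderiv ((hGf y hy).mul (hgf y hy)) ?_
    rw [sub_zero]; module
  · rw [sub_zero]
    refine HasFDerivAt.congr_fderiv (hi.neg.mul (((hG1f x hx).mul (hgf x hx)).add ((((hGf x hx).mul ((hg1f x hx).mul hz))).const_mul 2))) ?_
    simp only [Pi.neg_apply, Pi.mul_apply, ← hr, ← hT, ← hZ]
    module
  · rw [sub_zero]
    refine HasFDerivAt.congr_fderiv (hi.mul ((hGf x hx).mul (hg1f x hx))) ?_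
    simp only [Pi.neg_apply, Pi.mul_apply, ← hr, ← hT, ← hZ]
    module


lemma glue_pos_eq (x : ℝ) (hx : 0 < x) : expNegInvGlue x = Real.exp (-x⁻¹) := by
  simp [expNegInvGlue, not_le.2 hx]

/-- the profile in the inverted height -/
def gK (K z : ℝ) : ℝ := z * expNegInvGlue ((z - K) / (4 * K))

lemma gK_contDiff (K : ℝ) : ContDiff ℝ (⊤ : ℕ∞) (gK K) := by
  unfold gK
  exact contDiff_id.mul (expNegInvGlue.contDiff.comp ((contDiff_id.sub contDiff_const).div_const _))

lemma gK_zero (K z : ℝ) (hK : 1 ≤ K) (hz : z ≤ K) : gK K z = 0 := by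
  unfold gK
  rw [expNegInvGlue.zero_of_nonpos, mul_zero]
  apply div_nonpos_of_nonpos_of_nonneg <;> linarith

lemma gK_pos_eq (K z : ℝ) (hK : 1 ≤ K) (hz : K < z) :
    gK K z = z * Real.exp (-(4 * K) * (z - K)⁻¹) := by
  unfold gK
  rw [glue_pos_eq _ (div_pos (by linarith) (by linarith)), inv_div]
  congr 2; ring

lemma hasDerivAt_E (a k z : ℝ) (hz : k < z) :
    HasDerivAt (fun z => Real.exp (-a * (z - k)⁻¹))
      (a * (z - k)⁻¹ ^ 2 * Real.exp (-a * (z - k)⁻¹)) z := by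
  have h0 : z - k ≠ 0 := by linarith
  have h1 : HasDerivAt (fun z : ℝ => (z - k)⁻¹) (-((z - k)⁻¹ ^ 2)) z := by
    have := ((hasDerivAt_id z).sub_const k).inv h0
    refine this.congr_deriv ?_
    simp [div_eq_mul_inv]
  convert (h1.const_mul (-a)).exp using 1
  ring

lemma hasDerivAt_X (k z : ℝ) (hz : k < z) :
    HasDerivAt (fun z : ℝ => (z - k)⁻¹) (-((z - k)⁻¹ ^ 2)) z := by
  have h0 : z - k ≠ 0 := by linarith
  have := ((hasDerivAt_id z).sub_const k).inv h0
  refine this.congr_deriv ?_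
  simp [div_eq_mul_inv]

lemma gK_deriv (K z : ℝ) (hK : 1 ≤ K) (hz : K < z) :
    HasDerivAt (gK K) (Real.exp (-(4 * K) * (z - K)⁻¹) * (1 + z * (4 * K) * (z - K)⁻¹ ^ 2)) z := by
  have h1 := (hasDerivAt_id z).mul (hasDerivAt_E (4 * K) K z hz)
  have : gK K =ᶠ[𝓝 z] (fun z => id z * Real.exp (-(4 * K) * (z - K)⁻¹)) := by
    filter_upwards [lt_mem_nhds hz] with y hy
    exact gK_pos_eq K y hK hy
  refine (h1.congr_of_eventuallyEq this).congr_deriv ?_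
  simp only [id]; ring

lemma gK_deriv2 (K z : ℝ) (hK : 1 ≤ K) (hz : K < z) :
    deriv (deriv (gK K)) z = (4 * K) * (z - K)⁻¹ ^ 2 * Real.exp (-(4 * K) * (z - K)⁻¹)
      * (2 + z * (4 * K) * (z - K)⁻¹ ^ 2 - 2 * z * (z - K)⁻¹) := by
  have h1 := (hasDerivAt_E (4 * K) K z hz).mul
    (((((hasDerivAt_id z).mul_const (4 * K)).mul ((hasDerivAt_X K z hz).pow 2))).const_add 1)
  have : deriv (gK K) =ᶠ[𝓝 z] (fun z => Real.exp (-(4 * K) * (z - K)⁻¹) * (1 + id z * (4 * K) * (z - K)⁻¹ ^ 2)) := by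
    filter_upwards [lt_mem_nhds hz] with y hy
    exact (gK_deriv K y hK hy).deriv
  refine ((h1.congr_of_eventuallyEq this).congr_deriv ?_).deriv
  simp only [id, Pi.mul_apply, Pi.pow_apply]; ring

lemma gK_props (K z : ℝ) (hK : 1 ≤ K) (hz : K < z) :
    z * deriv (gK K) z - gK K z =
      z ^ 2 * (4 * K) * (z - K)⁻¹ ^ 2 * Real.exp (-(4 * K) * (z - K)⁻¹) ∧
    (4 * K) ^ 2 / 2 * z * (z - K)⁻¹ ^ 4 * Real.exp (-(4 * K) * (z - K)⁻¹) ≤ deriv (deriv (gK K)) z := by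
  have hw : 0 < z - K := by linarith
  constructor
  · rw [(gK_deriv K z hK hz).deriv, gK_pos_eq K z hK hz]; ring
  · rw [gK_deriv2 K z hK hz]
    have hX : 0 < (z - K)⁻¹ := by positivity
    have hzX : z * (z - K)⁻¹ = 1 + K * (z - K)⁻¹ := by field_simp; ring
    set X := (z - K)⁻¹ with hXd
    set E := Real.exp (-(4 * K) * X)
    have hE : 0 < E := Real.exp_pos _
    have : (4 * K) ^ 2 / 2 * z * X ^ 4 * E = (4 * K) * X ^ 2 * E * ((4 * K) / 2 * (z * X) * X) := by ring
    rw [this]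
    refine mul_le_mul_of_nonneg_left ?_ (by positivity)
    have h2 : 2 + z * (4 * K) * X ^ 2 - 2 * z * X = 2 + (4 * K) * (z * X) * X - 2 * (z * X) := by ring
    rw [h2, hzX]
    nlinarith [mul_pos hX hX, mul_pos hX (by linarith : 0 < K), mul_pos (mul_pos hX hX) (by linarith : 0 < K)
      , mul_pos (mul_pos hX hX) (mul_pos (by linarith : 0 < K) (by linarith : 0 < K))]

lemma exists_F (s : ℝ) (hs : 0 ≤ s) : ∃ (F : ℝ → ℝ) (b f0 C : ℝ), ContDiff ℝ (⊤ : ℕ∞) F ∧ 0 < b ∧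
    0 < f0 ∧ 0 < C ∧ (∀ t ≤ 0, F t = 0) ∧
    (∀ t, 0 < t → 0 < F t ∧ 0 ≤ deriv F t ∧ b * F t ≤ t ^ 4 * (deriv (deriv F) t + 2 * s * deriv F t)) ∧
    (∀ t, 1 ≤ t → f0 ≤ F t ∧ F t ≤ C * t ∧ deriv F t ≤ C ∧ s * F t ≤ C) := by
  rcases hs.eq_or_lt with rfl | hs
  · have e1 : ∀ t : ℝ, 0 < t → t * expNegInvGlue t = t * Real.exp (-1 * (t - 0)⁻¹) := by
      intro t ht; rw [glue_pos_eq t ht]; simp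
    have d1 : ∀ t : ℝ, 0 < t → HasDerivAt (fun t => t * expNegInvGlue t)
        (Real.exp (-1 * (t - 0)⁻¹) * (1 + (t - 0)⁻¹)) t := by
      intro t ht
      have h1 := (hasDerivAt_id t).mul (hasDerivAt_E 1 0 t ht)
      have : (fun t => t * expNegInvGlue t) =ᶠ[𝓝 t] (fun z => id z * Real.exp (-1 * (z - 0)⁻¹)) := by
        filter_upwards [lt_mem_nhds ht] with y hy
        exact e1 y hy
      refine (h1.congr_of_eventuallyEq this).congr_deriv ?_
      have : t ≠ 0 := ht.ne'
      simp only [id, sub_zero]; field_simp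
    have d2 : ∀ t : ℝ, 0 < t → deriv (deriv (fun t => t * expNegInvGlue t)) t =
        (Real.exp (-1 * (t - 0)⁻¹) * ((t - 0)⁻¹ ^ 3)) := by
      intro t ht
      have h1 := (hasDerivAt_E 1 0 t ht).mul ((hasDerivAt_X 0 t ht).const_add 1)
      have : deriv (fun t => t * expNegInvGlue t) =ᶠ[𝓝 t] (fun z => Real.exp (-1 * (z - 0)⁻¹) * (1 + (z - 0)⁻¹)) := by
        filter_upwards [lt_mem_nhds ht] with y hy
        exact (d1 y hy).deriv
      refine ((h1.congr_of_eventuallyEq this).congr_deriv ?_).deriv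
      ring
    refine ⟨fun t => t * expNegInvGlue t, 1, Real.exp (-1), 2, contDiff_id.mul expNegInvGlue.contDiff,
      one_pos, Real.exp_pos _, by norm_num, ?_, ?_, ?_⟩
    · intro t ht; simp [expNegInvGlue.zero_of_nonpos ht]
    · intro t ht
      refine ⟨mul_pos ht (expNegInvGlue.pos_of_pos ht), ?_, ?_⟩
      · rw [(d1 t ht).deriv, sub_zero]; positivity
      · rw [d2 t ht, (d1 t ht).deriv]; simp only []
        rw [e1 t ht]; simp only [sub_zero]
        apply le_of_eq; field_simp; ring
    · intro t ht
      have ht0 : 0 < t := by linarith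
      have hi : t⁻¹ ≤ 1 := inv_le_one_of_one_le₀ ht
      have hi0 : 0 < t⁻¹ := by positivity
      rw [(d1 t ht0).deriv]; simp only []
      rw [e1 t ht0]; simp only [sub_zero]
      have hE1 : Real.exp (-1) ≤ Real.exp (-1 * t⁻¹) := Real.exp_le_exp.2 (by linarith)
      have hE2 : Real.exp (-1 * t⁻¹) ≤ 1 := Real.exp_le_one_iff.2 (by linarith)
      have hE0 := Real.exp_pos (-1 : ℝ)
      refine ⟨by nlinarith, by nlinarith, by nlinarith, by simp⟩
  · have hsi : 0 < s⁻¹ := by positivity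
    have e1 : ∀ t : ℝ, 0 < t → expNegInvGlue (s * t) = Real.exp (-s⁻¹ * (t - 0)⁻¹) := by
      intro t ht; rw [glue_pos_eq _ (mul_pos hs ht)]; simp [mul_comm]
    have d1 : ∀ t : ℝ, 0 < t → HasDerivAt (fun t => expNegInvGlue (s * t))
        (s⁻¹ * (t - 0)⁻¹ ^ 2 * Real.exp (-s⁻¹ * (t - 0)⁻¹)) t := by
      intro t ht
      have h1 := (hasDerivAt_E s⁻¹ 0 t ht)
      refine h1.congr_of_eventuallyEq ?_
      filter_upwards [lt_mem_nhds ht] with y hy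
      exact e1 y hy
    have d2 : ∀ t : ℝ, 0 < t → deriv (deriv (fun t => expNegInvGlue (s * t))) t =
        s⁻¹ * Real.exp (-s⁻¹ * (t - 0)⁻¹) * (s⁻¹ * (t - 0)⁻¹ ^ 4 - 2 * (t - 0)⁻¹ ^ 3) := by
      intro t ht
      have h1 := ((((hasDerivAt_X 0 t ht).pow 2)).const_mul s⁻¹).mul (hasDerivAt_E s⁻¹ 0 t ht)
      have : deriv (fun t => expNegInvGlue (s * t)) =ᶠ[𝓝 t] (fun z => s⁻¹ * (z - 0)⁻¹ ^ 2 * Real.exp (-s⁻¹ * (z - 0)⁻¹)) := by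
        filter_upwards [lt_mem_nhds ht] with y hy
        exact (d1 y hy).deriv
      refine ((h1.congr_of_eventuallyEq this).congr_deriv ?_).deriv
      simp only [Pi.pow_apply]
      ring
    refine ⟨fun t => expNegInvGlue (s * t), s⁻¹ ^ 2 / 2, Real.exp (-s⁻¹), 1 + s⁻¹ + s,
      expNegInvGlue.contDiff.comp (contDiff_const.mul contDiff_id),
      by positivity, Real.exp_pos _, by positivity, ?_, ?_, ?_⟩
    · intro t ht
      exact expNegInvGlue.zero_of_nonpos (mul_nonpos_of_nonneg_of_nonpos hs.le ht)
    · intro t ht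
      refine ⟨expNegInvGlue.pos_of_pos (mul_pos hs ht), ?_, ?_⟩
      · rw [(d1 t ht).deriv, sub_zero]; positivity
      · rw [d2 t ht, (d1 t ht).deriv]; simp only []
        rw [e1 t ht]; simp only [sub_zero]
        have hE0 := Real.exp_pos (-s⁻¹ * t⁻¹)
        set E := Real.exp (-s⁻¹ * t⁻¹)
        have : t ^ 4 * (s⁻¹ * E * (s⁻¹ * t⁻¹ ^ 4 - 2 * t⁻¹ ^ 3) + 2 * s * (s⁻¹ * t⁻¹ ^ 2 * E))
          = E * (s⁻¹ ^ 2 - 2 * s⁻¹ * t + 2 * t ^ 2) := by field_simp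
        rw [this]
        nlinarith [mul_nonneg hE0.le (sq_nonneg (s⁻¹ - 2 * t))]
    · intro t ht
      have ht0 : 0 < t := by linarith
      have hi : t⁻¹ ≤ 1 := inv_le_one_of_one_le₀ ht
      have hi0 : 0 < t⁻¹ := by positivity
      rw [(d1 t ht0).deriv]; simp only []
      rw [e1 t ht0]; simp only [sub_zero]
      have hE1 : Real.exp (-s⁻¹) ≤ Real.exp (-s⁻¹ * t⁻¹) := Real.exp_le_exp.2 (by nlinarith)
      have hE2 : Real.exp (-s⁻¹ * t⁻¹) ≤ 1 := Real.exp_le_one_iff.2 (by nlinarith)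
      have hE0 := Real.exp_pos (-s⁻¹ * t⁻¹)
      refine ⟨hE1, by nlinarith, ?_, by nlinarith⟩
      have h3 : t⁻¹ ^ 2 ≤ 1 := by nlinarith
      have : s⁻¹ * t⁻¹ ^ 2 * Real.exp (-s⁻¹ * t⁻¹) ≤ s⁻¹ * 1 * 1 := by gcongr
      linarith

lemma exists_zeta (p : ℝ) (hp : 1 < p) : ∃ (Z : ℝ → ℝ) (C : ℝ), ContDiff ℝ (⊤ : ℕ∞) Z ∧ 0 < C ∧
    (∀ t, 0 ≤ Z t) ∧ (∀ t, Z t ≤ 1) ∧ (∀ t ≤ 1, Z t = 1) ∧ (∀ t, 2 ≤ t → Z t = 0) ∧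
    (∀ t, |deriv Z t| ≤ C * Z t ^ (1 / p)) ∧ (∀ t, |deriv (deriv Z) t| ≤ C * Z t ^ (1 / p)) := by
  set η : ℝ → ℝ := fun t => Real.smoothTransition (2 - t) with hη
  have hηc : ContDiff ℝ (⊤ : ℕ∞) η := Real.smoothTransition.contDiff.comp (contDiff_const.sub contDiff_id)
  have hη0 : ∀ t, 0 ≤ η t := fun t => Real.smoothTransition.nonneg _
  have hη1 : ∀ t, η t ≤ 1 := fun t => Real.smoothTransition.le_one _
  have hη2 : ∀ t ≤ 1, η t = 1 := fun t ht => Real.smoothTransition.one_of_one_le (by linarith)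
  have hη3 : ∀ t, 2 ≤ t → η t = 0 := fun t ht => Real.smoothTransition.zero_of_nonpos (by linarith)
  have hd : ContDiff ℝ (⊤ : ℕ∞) (deriv η) := (contDiff_infty_iff_deriv.1 hηc).2
  have hdd : ContDiff ℝ (⊤ : ℕ∞) (deriv (deriv η)) := (contDiff_infty_iff_deriv.1 hd).2
  have s1 : HasCompactSupport (deriv η) := by
    apply HasCompactSupport.of_support_subset_isCompact (isCompact_Icc (a := (1:ℝ)) (b := 2))
    intro t ht
    by_contra h
    apply ht
    rw [Set.mem_Icc, not_and_or, not_le, not_le] at h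
    rcases h with h | h
    · have : η =ᶠ[𝓝 t] fun _ => 1 := by
        filter_upwards [gt_mem_nhds h] with y hy using hη2 y hy.le
      rw [this.deriv_eq]; simp
    · have : η =ᶠ[𝓝 t] fun _ => 0 := by
        filter_upwards [lt_mem_nhds h] with y hy using hη3 y hy.le
      rw [this.deriv_eq]; simp
  have s2 : HasCompactSupport (deriv (deriv η)) := s1.deriv
  obtain ⟨C1, hC1⟩ := s1.exists_bound_of_continuous hd.continuous
  obtain ⟨C2, hC2⟩ := s2.exists_bound_of_continuous hdd.continuous
  have hC10 : 0 ≤ C1 := (norm_nonneg _).trans (hC1 0)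
  have hC20 : 0 ≤ C2 := (norm_nonneg _).trans (hC2 0)
  obtain ⟨m, hm⟩ := exists_nat_ge (2 / (p - 1))
  have hp1 : 0 < p - 1 := by linarith
  have hkp : ((m + 2 : ℕ) : ℝ) * (1 / p) ≤ m := by
    rw [div_le_iff₀ hp1] at hm
    push_cast
    rw [mul_one_div, div_le_iff₀ (by linarith)]
    linarith
  have hpow : ∀ t, η t ^ m ≤ (η t ^ (m + 2)) ^ (1 / p) := by
    intro t
    rw [← Real.rpow_natCast (η t) (m + 2), ← Real.rpow_mul (hη0 t)]
    rcases (hη0 t).eq_or_lt with h | h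
    · rw [← h]
      rw [Real.zero_rpow (by positivity)]
      have : m ≠ 0 := by
        rintro rfl
        simp at hkp
        have : 0 < p⁻¹ := inv_pos.2 (by linarith)
        linarith
      simp [this]
    · rw [← Real.rpow_natCast (η t) m]
      exact Real.rpow_le_rpow_of_exponent_ge h (hη1 t) hkp
  have D1 : ∀ t, HasDerivAt (fun t => η t ^ (m + 2)) (((m + 2 : ℕ) : ℝ) * η t ^ (m + 1) * deriv η t) t := by
    intro t
    exact ((hηc.differentiable (by simp)).differentiableAt.hasDerivAt).pow (m + 2)
  have D1' : deriv (fun t => η t ^ (m + 2)) = fun t => (((m + 2 : ℕ) : ℝ) * η t ^ (m + 1) * deriv η t) :=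
    funext fun t => (D1 t).deriv
  have D2 : ∀ t, deriv (deriv (fun t => η t ^ (m + 2))) t =
      ((m + 2 : ℕ) : ℝ) * (((m + 1 : ℕ) : ℝ) * η t ^ m * deriv η t) * deriv η t
        + ((m + 2 : ℕ) : ℝ) * η t ^ (m + 1) * deriv (deriv η) t := by
    intro t
    rw [D1']
    have h1 : HasDerivAt η (deriv η t) t := (hηc.differentiable (by simp)).differentiableAt.hasDerivAt
    have h2 : HasDerivAt (deriv η) (deriv (deriv η) t) t := (hd.differentiable (by simp)).differentiableAt.hasDerivAt
    exact (((h1.pow (m + 1)).const_mul _).mul h2).deriv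
  have hpm : ∀ t, η t ^ (m + 1) ≤ η t ^ m := fun t => pow_le_pow_of_le_one (hη0 t) (hη1 t) (by omega)
  refine ⟨fun t => η t ^ (m + 2), (m + 2 : ℕ) * C1 + (m + 2 : ℕ) * ((m + 1 : ℕ)) * C1 * C1 + (m + 2 : ℕ) * C2 + 1,
    hηc.pow _, by positivity, fun t => pow_nonneg (hη0 t) _, fun t => pow_le_one₀ (hη0 t) (hη1 t), ?_, ?_, ?_, ?_⟩
  · intro t ht; simp [hη2 t ht]
  · intro t ht; simp [hη3 t ht]
  · intro t
    rw [(D1 t).deriv]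
    have a0 := hη0 t
    have hC1t : |deriv η t| ≤ C1 := hC1 t
    have hq : 0 ≤ (η t ^ (m + 2)) ^ (1 / p) := by positivity
    have : |((m + 2 : ℕ) : ℝ) * η t ^ (m + 1) * deriv η t| ≤ ((m + 2 : ℕ) : ℝ) * (η t ^ (m + 2)) ^ (1 / p) * C1 := by
      rw [abs_mul, abs_of_nonneg (by positivity : 0 ≤ ((m + 2 : ℕ) : ℝ) * η t ^ (m + 1))]
      gcongr
      exact (hpm t).trans (hpow t)
    refine this.trans ?_
    have : 0 ≤ (((m + 2 : ℕ) : ℝ) * ((m + 1 : ℕ)) * C1 * C1 + (m + 2 : ℕ) * C2 + 1) * (η t ^ (m + 2)) ^ (1 / p) := by positivity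
    nlinarith
  · intro t
    rw [D2]
    have a0 := hη0 t
    have hC1t : |deriv η t| ≤ C1 := hC1 t
    have hC2t : |deriv (deriv η) t| ≤ C2 := hC2 t
    have hq : 0 ≤ (η t ^ (m + 2)) ^ (1 / p) := by positivity
    have h1 : |((m + 2 : ℕ) : ℝ) * (((m + 1 : ℕ) : ℝ) * η t ^ m * deriv η t) * deriv η t| ≤
        ((m + 2 : ℕ) : ℝ) * (((m + 1 : ℕ) : ℝ) * (η t ^ (m + 2)) ^ (1 / p) * C1) * C1 := by
      rw [abs_mul, abs_mul, abs_mul, abs_of_nonneg (by positivity : 0 ≤ ((m + 2 : ℕ) : ℝ)),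
        abs_of_nonneg (by positivity : 0 ≤ ((m + 1 : ℕ) : ℝ) * η t ^ m)]
      gcongr
      exact hpow t
    have h2 : |((m + 2 : ℕ) : ℝ) * η t ^ (m + 1) * deriv (deriv η) t| ≤ ((m + 2 : ℕ) : ℝ) * (η t ^ (m + 2)) ^ (1 / p) * C2 := by
      rw [abs_mul, abs_of_nonneg (by positivity : 0 ≤ ((m + 2 : ℕ) : ℝ) * η t ^ (m + 1))]
      gcongr
      exact (hpm t).trans (hpow t)
    refine (abs_add_le _ _).trans ?_
    have : 0 ≤ (((m + 2 : ℕ) : ℝ) * C1 + 1) * (η t ^ (m + 2)) ^ (1 / p) := by positivity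
    nlinarith


lemma xs_bound (X S : ℝ) (hX : 0 < X) (hS1S : 1 ≤ S) :
    X ≤ S⁻¹ + X ^ 4 * S ^ 3 ∧ X ^ 2 ≤ S⁻¹ + X ^ 4 * S ^ 3 := by
  have hS0 : 0 < S := by linarith
  have hp : 0 ≤ X ^ 4 * S ^ 3 := by positivity
  have h3 : 0 < S⁻¹ := by positivity
  have h2 : S⁻¹ ≤ 1 := inv_le_one_of_one_le₀ hS1S
  by_cases h : X ≤ S⁻¹
  · refine ⟨by linarith, ?_⟩
    have : X ^ 2 ≤ X := by rw [sq]; exact mul_le_of_le_one_left hX.le (h.trans h2)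
    linarith
  · push Not at h
    have h1 : 1 ≤ X * S := by
      rw [inv_lt_iff_one_lt_mul₀ hS0] at h; linarith
    have e3 : X * 1 ≤ X * (X * S) ^ 3 := by gcongr; exact one_le_pow₀ h1
    have e2 : X ^ 2 * 1 ≤ X ^ 2 * (X * S) ^ 2 := by gcongr; exact one_le_pow₀ h1
    have h5 : X ^ 4 * S ^ 2 ≤ X ^ 4 * S ^ 3 := by
      gcongr
      norm_num
    constructor
    · have : X * (X * S) ^ 3 = X ^ 4 * S ^ 3 := by ring
      linarith
    · have : X ^ 2 * (X * S) ^ 2 = X ^ 4 * S ^ 2 := by ring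
      linarith

lemma bracket (K C b : ℝ) (hK : 1 ≤ K) (hC : 0 ≤ C) (hb : 0 < b) : ∃ t1 : ℝ, 0 ≤ t1 ∧
    ∀ τ z : ℝ, t1 < τ → K < z →
      C * (z * deriv (gK K) z - gK K z) ≤
        b * ((τ - t1) ^ 4)⁻¹ * gK K z + (Real.exp τ) ^ 2 * deriv (deriv (gK K)) z := by
  set a := 4 * K with ha
  have ha0 : 0 < a := by linarith
  set S1 : ℝ := 1 + 2 * C / a * (1 + K) + 384 * (C * a * (1 + K)) / b with hS1
  have hA : 0 ≤ 2 * C / a * (1 + K) := by positivity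
  have hB : 0 ≤ 384 * (C * a * (1 + K)) / b := by positivity
  have hS1' : 1 ≤ S1 := by linarith
  have hS10 : 0 < S1 := by linarith
  refine ⟨2 * Real.log S1, by have := Real.log_nonneg hS1'; linarith, ?_⟩
  intro τ z hτ hz
  set t := τ - 2 * Real.log S1 with ht
  have ht0 : 0 < t := by linarith
  obtain ⟨hq, hg2⟩ := gK_props K z hK hz
  set S := Real.exp (τ / 2) with hS
  have hS0 : 0 < S := Real.exp_pos _
  have hR : Real.exp τ = S ^ 2 := by rw [hS, ← Real.exp_nat_mul]; congr 1; push_cast; ring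
  have hSS : S = S1 * Real.exp (t / 2) := by
    rw [hS, show τ / 2 = Real.log S1 + t / 2 by rw [ht]; ring, Real.exp_add, Real.exp_log hS10]
  have hexp : t ^ 4 / 384 ≤ Real.exp (t / 2) := by
    have := Real.pow_div_factorial_le_exp (t / 2) (by positivity) 4
    simp only [Nat.factorial] at this
    push_cast at this
    linarith [show (t/2)^4 / (4 * (3 * (2 * (1 * 1)))) = t ^ 4 / 384 by ring]
  have hexp1 : 1 ≤ Real.exp (t / 2) := Real.one_le_exp (by positivity)
  have hSge : S1 ≤ S := by rw [hSS]; exact le_mul_of_one_le_right hS10.le hexp1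
  have hSt : S1 * t ^ 4 ≤ 384 * S := by
    rw [hSS]
    have := mul_le_mul_of_nonneg_left hexp hS10.le
    linarith
  have hS1S : 1 ≤ S := hS1'.trans hSge
  rw [hq, gK_pos_eq K z hK hz]
  have hw : 0 < z - K := by linarith
  have hX : 0 < (z - K)⁻¹ := by positivity
  have hzX : z * (z - K)⁻¹ = 1 + K * (z - K)⁻¹ := by field_simp; ring
  set X := (z - K)⁻¹ with hXd
  set E := Real.exp (-(4 * K) * X)
  have hE : 0 < E := Real.exp_pos _
  have hz0 : 0 < z := by linarith
  obtain ⟨hx1, hx2⟩ := xs_bound X S hX hS1S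
  have hm : C * a * X + C * a * K * X ^ 2 ≤ b * (t ^ 4)⁻¹ + (S ^ 2) ^ 2 * (a ^ 2 / 2 * X ^ 4) := by
    have i1 : C * a * X ≤ C * a * (S⁻¹ + X ^ 4 * S ^ 3) := by gcongr
    have i2 : C * a * K * X ^ 2 ≤ C * a * K * (S⁻¹ + X ^ 4 * S ^ 3) := by gcongr
    have i3 : C * a * (1 + K) * S⁻¹ ≤ b * (t ^ 4)⁻¹ := by
      rw [← div_eq_mul_inv, ← div_eq_mul_inv, div_le_div_iff₀ hS0 (by positivity)]
      have : 384 * (C * a * (1 + K)) / b ≤ S1 := by linarith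
      rw [div_le_iff₀ hb] at this
      have h4 : 0 ≤ t ^ 4 := by positivity
      have := mul_le_mul_of_nonneg_right this h4
      have h5 := mul_le_mul_of_nonneg_left hSt hb.le
      linarith
    have i4 : C * a * (1 + K) * (X ^ 4 * S ^ 3) ≤ (S ^ 2) ^ 2 * (a ^ 2 / 2 * X ^ 4) := by
      have : 2 * C / a * (1 + K) ≤ S := by linarith
      have h5 : C * a * (1 + K) ≤ S * (a ^ 2 / 2) := by
        have := mul_le_mul_of_nonneg_right this (by positivity : 0 ≤ a ^ 2 / 2)
        calc C * a * (1 + K) = 2 * C / a * (1 + K) * (a ^ 2 / 2) := by field_simp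
          _ ≤ _ := this
      have h6 : 0 ≤ X ^ 4 * S ^ 3 := by positivity
      have := mul_le_mul_of_nonneg_right h5 h6
      linarith [show S * (a ^ 2 / 2) * (X ^ 4 * S ^ 3) = (S ^ 2) ^ 2 * (a ^ 2 / 2 * X ^ 4) by ring]
    linarith [show C * a * (S⁻¹ + X ^ 4 * S ^ 3) + C * a * K * (S⁻¹ + X ^ 4 * S ^ 3) =
      C * a * (1 + K) * S⁻¹ + C * a * (1 + K) * (X ^ 4 * S ^ 3) by ring]
  have h7 : C * (z ^ 2 * a * X ^ 2 * E) = (z * E) * (C * a * X + C * a * K * X ^ 2) := by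
    have : C * (z ^ 2 * a * X ^ 2 * E) = z * E * (C * a * X * (z * X)) := by ring
    rw [this, hzX]; ring
  rw [h7, hR]
  have h8 := mul_le_mul_of_nonneg_left hm (by positivity : 0 ≤ z * E)
  have h9 := mul_le_mul_of_nonneg_left hg2 (by positivity : 0 ≤ (S ^ 2) ^ 2)
  refine h8.trans (le_trans (le_of_eq ?_) (add_le_add_right h9 _))
  rw [ha]; ring

lemma q_bound (K p : ℝ) (hK : 1 ≤ K) (hp : 1 < p) : ∃ C : ℝ, 0 < C ∧ ∀ z, K < z →
    z * deriv (gK K) z - gK K z ≤ C * gK K z ^ (1 / p) := by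
  set a := 4 * K with ha
  have ha0 : 0 < a := by linarith
  have hp0 : 0 < p := by linarith
  have hp1 : 1 / p < 1 := by rw [div_lt_one hp0]; exact hp
  set δ := (1 - 1 / p) * a / 2 with hδ
  have hδ0 : 0 < δ := by have : 0 < 1 - 1 / p := by linarith
                         positivity
  refine ⟨a * (1 + K / δ) ^ 2, by positivity, ?_⟩
  intro z hz
  obtain ⟨hq, -⟩ := gK_props K z hK hz
  rw [hq, gK_pos_eq K z hK hz]
  have hw : 0 < z - K := by linarith
  have hX : 0 < (z - K)⁻¹ := by positivity
  have hzX : z * (z - K)⁻¹ = 1 + K * (z - K)⁻¹ := by field_simp; ring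
  set X := (z - K)⁻¹ with hXd
  have hz0 : 0 < z := by linarith
  have h1 : z * X ≤ (1 + K / δ) * Real.exp (δ * X) := by
    rw [hzX]
    have e1 : 1 ≤ Real.exp (δ * X) := Real.one_le_exp (by positivity)
    have e2 : δ * X ≤ Real.exp (δ * X) := by have := Real.add_one_le_exp (δ * X); linarith
    have : K / δ * (δ * X) = K * X := by field_simp
    have hk : 0 < K / δ := by positivity
    nlinarith
  have h2 : Real.exp (-(4 * K) * X) ^ (1 / p) ≤ (z * Real.exp (-(4 * K) * X)) ^ (1 / p) := by
    apply Real.rpow_le_rpow (Real.exp_pos _).le _ (by positivity)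
    have := Real.exp_pos (-(4 * K) * X)
    nlinarith
  have h3 : Real.exp (-(4 * K) * X) = (Real.exp (δ * X))⁻¹ ^ 2 * Real.exp (-(4 * K) * X) ^ (1 / p) := by
    rw [← Real.exp_mul, ← Real.exp_neg, ← Real.exp_nat_mul, ← Real.exp_add]
    congr 1
    rw [hδ, ha]; push_cast; ring
  have h4 : z ^ 2 * a * X ^ 2 * Real.exp (-(4 * K) * X) =
      a * (z * X * (Real.exp (δ * X))⁻¹) ^ 2 * Real.exp (-(4 * K) * X) ^ (1 / p) := by
    conv_lhs => rw [h3]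
    ring
  rw [h4]
  gcongr
  rw [← div_eq_mul_inv, div_le_iff₀ (Real.exp_pos _)]
  exact h1

lemma young_dich (v B f0 p : ℝ) (hv : 0 ≤ v) (hB : 0 ≤ B) (hf : 0 < f0) (hp : 1 < p) :
    v * B ≤ 1 / 2 * f0 * v ^ p + (2 / f0) ^ (1 / (p - 1)) * B ^ (1 + 1 / (p - 1)) := by
  have hp1 : 0 < p - 1 := by linarith
  have hsecond : 0 ≤ (2 / f0) ^ (1 / (p - 1)) * B ^ (1 + 1 / (p - 1)) := by positivity
  have hfirst : 0 ≤ 1 / 2 * f0 * v ^ p := by positivity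
  rcases hv.eq_or_lt with rfl | hv0
  · rw [zero_mul]; linarith
  rcases hB.eq_or_lt with rfl | hB0
  · rw [mul_zero]; linarith
  by_cases h : B ≤ 1 / 2 * f0 * v ^ (p - 1)
  · have : v * B ≤ v * (1 / 2 * f0 * v ^ (p - 1)) := by gcongr
    have e : v ^ p = v * v ^ (p - 1) := by
      rw [← Real.rpow_one_add' hv (by linarith)]; congr 1; ring
    rw [e]; linarith
  · push Not at h
    have h1 : v ^ (p - 1) ≤ 2 / f0 * B := by
      rw [div_mul_eq_mul_div, le_div_iff₀ hf]; linarith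
    have h2 : v ≤ (2 / f0 * B) ^ (1 / (p - 1)) := by
      have := Real.rpow_le_rpow (by positivity) h1 (by positivity : 0 ≤ 1 / (p - 1))
      rwa [← Real.rpow_mul hv, mul_one_div_cancel hp1.ne', Real.rpow_one] at this
    have h3 : v * B ≤ (2 / f0 * B) ^ (1 / (p - 1)) * B := by gcongr
    rw [Real.mul_rpow (by positivity) hB] at h3
    rw [Real.rpow_add hB0, Real.rpow_one]
    linarith


lemma deriv_zero_Iic (f : ℝ → ℝ) (k a : ℝ) (hf : Differentiable ℝ f) (h : ∀ t ≤ k, f t = a) :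
    ∀ t ≤ k, deriv f t = 0 := by
  intro t ht
  have h' : Set.EqOn f (fun _ => a) (Set.Iic k) := fun t ht => h t ht
  rw [← (hf t).derivWithin (uniqueDiffOn_Iic k t ht), derivWithin_congr h' (h t ht)]
  simp

/-- the algebraic heart of the ground state representation -/
lemma radial_id (n α c κ s ek Φ Φ1 Φ2 g g1 g2 z R2 : ℝ) (hroot : α ^ 2 - (n - 2) * α + c - n + 1 = 0)
    (hκ : κ = α + 3 - n) (hs : s = (n - 2) / 2 - α) :
    (ek * (Φ2 - 2 * κ * Φ1 + κ ^ 2 * Φ)) * g - (n - 2) * (ek * (Φ1 - κ * Φ)) * g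
      + 2 * (ek * (Φ1 - κ * Φ)) * (z * g1)
      + (ek * Φ) * (R2 * g2 - (2 * n - 4) * (z * g1)) + c * (ek * Φ * g) =
    ek * ((Φ2 + 2 * s * Φ1) * g + 2 * (Φ1 - (α + 1) * Φ) * (z * g1 - g) + R2 * (Φ * g2)) := by
  subst hκ hs
  linear_combination (ek * Φ * g) * hroot

lemma err_bound (p s t T Zv Z1 Z2 F F1 g q R C1 C2 Cq f0 : ℝ) (hp : 1 < p) (hs : 0 ≤ s)
    (hT : 1 ≤ T) (htT : T ≤ t) (htT2 : t ≤ 2 * T) (hRt : Real.exp t ≤ R)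
    (hZ0 : 0 ≤ Zv) (hC1 : 0 < C1) (hC2 : 0 < C2) (hCq : 0 < Cq)
    (hZ1 : |Z1| ≤ C1 * Zv ^ (1 / p)) (hZ2 : |Z2| ≤ C1 * Zv ^ (1 / p))
    (hF0 : 0 ≤ F) (hF : F ≤ C2 * t) (hF10 : 0 ≤ F1) (hF1 : F1 ≤ C2) (hsF : s * F ≤ C2)
    (hg0 : 0 ≤ g) (hgR : g ≤ R) (hq0 : 0 ≤ q) (hq : q ≤ Cq * g ^ (1 / p)) :
    -((2 * F1 * (Z1 / T) + F * (Z2 / T ^ 2) + 2 * s * (F * (Z1 / T))) * g + 2 * (F * (Z1 / T)) * q)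
      ≤ (6 * C1 * C2 * (1 + Cq * (1 - 1 / p)⁻¹)) * (Zv * g) ^ (1 / p) * R ^ (1 - 1 / p) / T := by
  have hT0 : 0 < T := by linarith
  have hp0 : 0 < p := by linarith
  have hp1 : 1 / p < 1 := by rw [div_lt_one hp0]; exact hp
  have hR0 : 0 < R := (Real.exp_pos t).trans_le hRt
  set Y := Zv ^ (1 / p) with hY
  have hY0 : 0 ≤ Y := by positivity
  have hFT : F ≤ 2 * C2 * T := by nlinarith
  set A := C1 * Y with hA
  have hA0 : 0 ≤ A := by positivity
  have hz1 : |Z1 / T| ≤ A / T := by rw [abs_div, abs_of_pos hT0]; gcongr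
  have hz2 : |Z2 / T ^ 2| ≤ A / T ^ 2 := by rw [abs_div, abs_of_pos (by positivity : 0 < T ^ 2)]; gcongr
  have a1 : |2 * F1 * (Z1 / T)| ≤ 2 * C2 * (A / T) := by
    rw [abs_mul, abs_of_nonneg (by positivity : 0 ≤ 2 * F1)]; gcongr
  have a2 : |F * (Z2 / T ^ 2)| ≤ 2 * C2 * (A / T) := by
    rw [abs_mul, abs_of_nonneg hF0]
    calc F * |Z2 / T ^ 2| ≤ (2 * C2 * T) * (A / T ^ 2) := by gcongr
      _ = 2 * C2 * (A / T) := by field_simp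
  have a3 : |2 * s * (F * (Z1 / T))| ≤ 2 * C2 * (A / T) := by
    rw [show 2 * s * (F * (Z1 / T)) = 2 * (s * F) * (Z1 / T) by ring, abs_mul,
      abs_of_nonneg (by positivity : 0 ≤ 2 * (s * F))]; gcongr
  have a4 : |2 * (F * (Z1 / T))| ≤ 4 * C2 * A := by
    rw [show 2 * (F * (Z1 / T)) = 2 * F * (Z1 / T) by ring, abs_mul,
      abs_of_nonneg (by positivity : 0 ≤ 2 * F)]
    calc 2 * F * |Z1 / T| ≤ 2 * (2 * C2 * T) * (A / T) := by gcongr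
      _ = 4 * C2 * A := by field_simp; ring
  have b1 : -(2 * F1 * (Z1 / T) + F * (Z2 / T ^ 2) + 2 * s * (F * (Z1 / T))) ≤ 6 * C2 * (A / T) := by
    have := neg_abs_le (2 * F1 * (Z1 / T))
    have := neg_abs_le (F * (Z2 / T ^ 2))
    have := neg_abs_le (2 * s * (F * (Z1 / T)))
    linarith
  have b2 : -(2 * (F * (Z1 / T))) ≤ 6 * C2 * A := by
    have := neg_abs_le (2 * (F * (Z1 / T)))
    have : 0 ≤ C2 * A := by positivity
    linarith
  have h1 : -((2 * F1 * (Z1 / T) + F * (Z2 / T ^ 2) + 2 * s * (F * (Z1 / T))) * g + 2 * (F * (Z1 / T)) * q)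
      ≤ 6 * C2 * A * (g / T + q) := by
    have := mul_le_mul_of_nonneg_right b1 hg0
    have := mul_le_mul_of_nonneg_right b2 hq0
    have e : 6 * C2 * A * (g / T + q) = 6 * C2 * (A / T) * g + 6 * C2 * A * q := by ring
    rw [e]; linarith
  refine h1.trans ?_
  set W := R ^ (1 - 1 / p) with hW
  have hW0 : 0 < W := by positivity
  set θ := 1 - 1 / p with hθ
  have hθ0 : 0 < θ := by linarith
  have hgW : g ≤ g ^ (1 / p) * W := by
    rcases hg0.eq_or_lt with h | h
    · rw [← h]; positivity
    · calc g = g ^ (1 / p) * g ^ θ := by rw [← Real.rpow_add h, hθ]; simp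
        _ ≤ _ := by
            gcongr
            rw [hW]; exact Real.rpow_le_rpow hg0 hgR hθ0.le
  have hTW : T ≤ θ⁻¹ * W := by
    have : Real.exp (θ * t) ≤ W := by
      rw [mul_comm, Real.exp_mul]; exact Real.rpow_le_rpow (Real.exp_pos _).le hRt hθ0.le
    have h2 := Real.add_one_le_exp (θ * t)
    have h3 : θ * T ≤ θ * t := by gcongr
    rw [inv_mul_eq_div, le_div_iff₀ hθ0]; linarith
  have hqW : q ≤ Cq * g ^ (1 / p) * (θ⁻¹ * W) / T := by
    rw [le_div_iff₀ hT0]; gcongr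
  have h5 : g / T + q ≤ (1 + Cq * θ⁻¹) * g ^ (1 / p) * W / T := by
    have : g / T ≤ g ^ (1 / p) * W / T := by gcongr
    calc g / T + q ≤ g ^ (1 / p) * W / T + Cq * g ^ (1 / p) * (θ⁻¹ * W) / T := add_le_add this hqW
      _ = _ := by ring
  calc 6 * C2 * A * (g / T + q) ≤ 6 * C2 * A * ((1 + Cq * θ⁻¹) * g ^ (1 / p) * W / T) := by gcongr
    _ = _ := by rw [Real.mul_rpow hZ0 hg0, hA, ← hY]; ring

lemma young_final (n α κ p v y R T M f0 : ℝ) (hp : 1 < p) (hβ : 1 / (p - 1) ≤ α / 2)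
    (hκ : κ = α + 3 - n) (hv : 0 ≤ v) (hy : 0 ≤ y) (hR : 1 ≤ R) (hT : 1 ≤ T) (hM : 0 ≤ M) (hf0 : 0 < f0) :
    v * (R ^ 2 * R ^ (-κ) * (M * y ^ (1 / p) * R ^ (1 - 1 / p) / T)) ≤
      1 / 2 * v ^ p * (R ^ (-κ) * (f0 * y)) +
       ((2 / f0) ^ (1 / (p - 1)) * M ^ (1 + 1 / (p - 1))) * T ^ (-(1 + 1 / (p - 1))) * R ^ n := by
  have hp0 : 0 < p := by linarith
  have hp1 : 0 < p - 1 := by linarith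
  have hR0 : 0 < R := by linarith
  have hT0 : 0 < T := by linarith
  set β := 1 / (p - 1) with hβd
  set B := M * R ^ (3 - 1 / p) * T⁻¹ with hB
  have hY := young_dich (v * y ^ (1 / p)) B f0 p (by positivity) (by positivity) hf0 hp
  rw [← hβd, Real.mul_rpow hv (by positivity), ← Real.rpow_mul hy, one_div_mul_cancel hp0.ne', Real.rpow_one] at hY
  have hβp : (3 - 1 / p) * (1 + β) = 3 + 2 * β := by rw [hβd]; field_simp; ring
  have hB1 : B ^ (1 + β) = M ^ (1 + β) * T ^ (-(1 + β)) * R ^ (3 + 2 * β) := by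
    rw [hB, Real.mul_rpow (by positivity) (by positivity), Real.mul_rpow hM (by positivity),
      ← Real.rpow_mul hR0.le, hβp, Real.inv_rpow hT0.le, Real.rpow_neg hT0.le]
    ring
  have h3 : R ^ (3 - 1 / p) = R ^ 2 * R ^ (1 - 1 / p) := by
    rw [← Real.rpow_natCast, ← Real.rpow_add hR0]; congr 1; push_cast; ring
  have e1 : v * (R ^ 2 * R ^ (-κ) * (M * y ^ (1 / p) * R ^ (1 - 1 / p) / T)) = R ^ (-κ) * (v * y ^ (1 / p) * B) := by
    rw [hB, h3]; ring
  have hRk : 0 < R ^ (-κ) := by positivity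
  rw [e1]
  refine (mul_le_mul_of_nonneg_left hY hRk.le).trans ?_
  rw [hB1]
  have h4 : R ^ (-κ) * R ^ (3 + 2 * β) ≤ R ^ n := by
    rw [← Real.rpow_add hR0]
    apply Real.rpow_le_rpow_of_exponent_le hR
    rw [hκ]; linarith
  have h5 : 0 ≤ (2 / f0) ^ β * M ^ (1 + β) * T ^ (-(1 + β)) := by positivity
  have := mul_le_mul_of_nonneg_left h4 h5
  linarith


/-- cut-off profile -/
def PhiT (F Z : ℝ → ℝ) (t1 T τ : ℝ) : ℝ := F (τ - t1) * Z ((τ - t1) / T)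
def PhiT1 (F Z : ℝ → ℝ) (t1 T τ : ℝ) : ℝ :=
  deriv F (τ - t1) * Z ((τ - t1) / T) + F (τ - t1) * (deriv Z ((τ - t1) / T) / T)
def PhiT2 (F Z : ℝ → ℝ) (t1 T τ : ℝ) : ℝ :=
  deriv (deriv F) (τ - t1) * Z ((τ - t1) / T) + 2 * deriv F (τ - t1) * (deriv Z ((τ - t1) / T) / T)
    + F (τ - t1) * (deriv (deriv Z) ((τ - t1) / T) / T ^ 2)

lemma gK_nonneg (K z : ℝ) (hK : 1 ≤ K) : 0 ≤ gK K z := by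
  rcases le_or_gt z K with h | h
  · rw [gK_zero K z hK h]
  · rw [gK_pos_eq K z hK h]; have : 0 < z := by linarith
    positivity

set_option maxHeartbeats 1000000 in
lemma test_scalar (n α κ s p K : ℝ) (hp : 1 < p) (hβ : 1 / (p - 1) ≤ α / 2) (hs : 0 ≤ s)
    (hκ : κ = α + 3 - n) (hK : 1 ≤ K) (hα : 0 < α) :
    ∃ (t1 C : ℝ) (F Z : ℝ → ℝ), 0 ≤ t1 ∧ 0 ≤ C ∧ ContDiff ℝ (⊤ : ℕ∞) F ∧ ContDiff ℝ (⊤ : ℕ∞) Z ∧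
      (∀ t ≤ 0, F t = 0) ∧ (∀ t, 0 < t → 0 < F t) ∧ (∀ t, 0 ≤ Z t) ∧ (∀ t ≤ 1, Z t = 1) ∧
      (∀ t, 2 ≤ t → Z t = 0) ∧
      ∀ T, 1 ≤ T → ∀ τ z v, z ≤ Real.exp τ → 0 ≤ v →
        v * (-(Real.exp τ ^ 2 * (Real.exp (-κ * τ) *
          ((PhiT2 F Z t1 T τ + 2 * s * PhiT1 F Z t1 T τ) * gK K z
            + 2 * (PhiT1 F Z t1 T τ - (α + 1) * PhiT F Z t1 T τ) * (z * deriv (gK K) z - gK K z)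
            + Real.exp τ ^ 2 * (PhiT F Z t1 T τ * deriv (deriv (gK K)) z))))) ≤
        1 / 2 * v ^ p * (Real.exp (-κ * τ) * PhiT F Z t1 T τ * gK K z) +
          C * T ^ (-(1 + 1 / (p - 1))) *
            (if t1 + T ≤ τ ∧ τ ≤ t1 + 2 * T then Real.exp τ ^ n else 0) := by
  obtain ⟨F, b, f0, C2, hFs, hb, hf0, hC2, hF0, hFp, hF1⟩ := exists_F s hs
  obtain ⟨Z, C1, hZs, hC1, hZ0, hZle, hZ1, hZ2, hZd, hZdd⟩ := exists_zeta p hp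
  obtain ⟨t1, ht1, hbr⟩ := bracket K (2 * α + 2) b hK (by linarith) hb
  obtain ⟨Cq, hCq, hq⟩ := q_bound K p hK hp
  have hp0 : 0 < p := by linarith
  have hp1 : 1 / p < 1 := by rw [div_lt_one hp0]; exact hp
  set M := 6 * C1 * C2 * (1 + Cq * (1 - 1 / p)⁻¹) with hM
  have hθ : 0 < 1 - 1 / p := by linarith
  have hM0 : 0 ≤ M := by positivity
  have hFd : Differentiable ℝ F := hFs.differentiable (by simp)
  have hFdd : Differentiable ℝ (deriv F) := (hFs.iterate_deriv 1).differentiable (by simp)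
  have hZdf : Differentiable ℝ Z := hZs.differentiable (by simp)
  have hZddf : Differentiable ℝ (deriv Z) := (hZs.iterate_deriv 1).differentiable (by simp)
  have hgs := gK_contDiff K
  have hgd : Differentiable ℝ (gK K) := hgs.differentiable (by simp)
  have hgdd : Differentiable ℝ (deriv (gK K)) := (hgs.iterate_deriv 1).differentiable (by simp)
  have dF := deriv_zero_Iic F 0 0 hFd hF0
  have ddF := deriv_zero_Iic _ 0 0 hFdd dF
  have dg := deriv_zero_Iic (gK K) K 0 hgd (fun t ht => gK_zero K t hK ht)
  have ddg := deriv_zero_Iic _ K 0 hgdd dg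
  have dZ := deriv_zero_Iic Z 1 1 hZdf hZ1
  have ddZ := deriv_zero_Iic _ 1 0 hZddf dZ
  have hp0' : (0:ℝ) ^ (1 / p) = 0 := Real.zero_rpow (by positivity)
  refine ⟨t1, (2 / f0) ^ (1 / (p - 1)) * M ^ (1 + 1 / (p - 1)), F, Z, ht1, by positivity, hFs, hZs,
    hF0, fun t ht => (hFp t ht).1, hZ0, hZ1, hZ2, ?_⟩
  intro T hT τ z v hz hv
  have hT0 : 0 < T := by linarith
  have hpos2 : 0 ≤ (2 / f0) ^ (1 / (p - 1)) * M ^ (1 + 1 / (p - 1)) * T ^ (-(1 + 1 / (p - 1))) *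
            (if t1 + T ≤ τ ∧ τ ≤ t1 + 2 * T then Real.exp τ ^ n else 0) := by
    apply mul_nonneg (by positivity)
    split_ifs <;> positivity
  have hg0 := gK_nonneg K z hK
  have hPhi0 : 0 ≤ PhiT F Z t1 T τ := by
    unfold PhiT
    apply mul_nonneg _ (hZ0 _)
    rcases le_or_gt (τ - t1) 0 with h | h
    · rw [hF0 _ h]
    · exact (hFp _ h).1.le
  have hpos1 : 0 ≤ 1 / 2 * v ^ p * (Real.exp (-κ * τ) * PhiT F Z t1 T τ * gK K z) := by positivity
  rcases le_or_gt z K with hzK | hzK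
  · rw [gK_zero K z hK hzK] at hpos1 ⊢
    rw [dg z hzK, ddg z hzK]
    simp only [mul_zero, sub_zero, add_zero, neg_zero, zero_add] at hpos1 ⊢
    exact hpos2
  rcases le_or_gt τ t1 with hτ | hτ
  · have e0 : PhiT F Z t1 T τ = 0 := by rw [PhiT, hF0 _ (by linarith)]; ring
    have e1 : PhiT1 F Z t1 T τ = 0 := by rw [PhiT1, hF0 _ (by linarith), dF _ (by linarith)]; ring
    have e2 : PhiT2 F Z t1 T τ = 0 := by
      rw [PhiT2, hF0 _ (by linarith), dF _ (by linarith), ddF _ (by linarith)]; ring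
    rw [e0, e1, e2]
    simp only [mul_zero, zero_mul, sub_zero, add_zero, neg_zero, zero_add]
    exact hpos2
  set t := τ - t1 with ht
  have ht0 : 0 < t := by linarith
  obtain ⟨hFt, hF1t, hF2t⟩ := hFp t ht0
  set R := Real.exp τ with hR
  have hR0 : 0 < R := Real.exp_pos _
  have hR1 : 1 ≤ R := Real.one_le_exp (by linarith)
  set g := gK K z with hg
  set q := z * deriv (gK K) z - g with hqd
  set g2 := deriv (deriv (gK K)) z with hg2
  have hq0 : 0 ≤ q := by
    rw [hqd, hg, (gK_props K z hK hzK).1]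
    have : 0 < z - K := by linarith
    positivity
  have hB := hbr τ z hτ hzK
  rw [← hg, ← hqd, ← hg2, ← ht, ← hR] at hB
  set Zv := Z (t / T) with hZv
  have hZv0 : 0 ≤ Zv := hZ0 _
  have main0 : 0 ≤ (deriv (deriv F) t + 2 * s * deriv F t) * g + 2 * deriv F t * q
      - (2 * α + 2) * F t * q + R ^ 2 * F t * g2 := by
    have h1 : F t * ((2 * α + 2) * q) ≤ F t * (b * (t ^ 4)⁻¹ * g + R ^ 2 * g2) := by gcongr
    have h2 : b * F t * (t ^ 4)⁻¹ ≤ deriv (deriv F) t + 2 * s * deriv F t := by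
      rw [← div_eq_mul_inv, div_le_iff₀ (by positivity)]; linarith
    have h3 := mul_le_mul_of_nonneg_right h2 hg0
    have h4 : 0 ≤ 2 * deriv F t * q := by positivity
    linarith
  set Z1 := deriv Z (t / T) with hZ1d
  set Z2 := deriv (deriv Z) (t / T) with hZ2d
  have eE : (PhiT2 F Z t1 T τ + 2 * s * PhiT1 F Z t1 T τ) * g
            + 2 * (PhiT1 F Z t1 T τ - (α + 1) * PhiT F Z t1 T τ) * q
            + R ^ 2 * (PhiT F Z t1 T τ * g2) =
      Zv * ((deriv (deriv F) t + 2 * s * deriv F t) * g + 2 * deriv F t * q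
      - (2 * α + 2) * F t * q + R ^ 2 * F t * g2) +
      ((2 * deriv F t * (Z1 / T) + F t * (Z2 / T ^ 2) + 2 * s * (F t * (Z1 / T))) * g
        + 2 * (F t * (Z1 / T)) * q) := by
    unfold PhiT PhiT1 PhiT2
    rw [← ht, ← hZv, ← hZ1d, ← hZ2d]; ring
  have hmain := mul_nonneg hZv0 main0
  rw [eE]
  have hek : Real.exp (-κ * τ) = R ^ (-κ) := by rw [hR, ← Real.exp_mul]; ring_nf
  rw [hek] at hpos1 ⊢
  have hRk : 0 < R ^ (-κ) := by positivity
  have hcase0 : Z1 = 0 → Z2 = 0 → v * (-(R ^ 2 * (R ^ (-κ) * (Zv * ((deriv (deriv F) t + 2 * s * deriv F t) * g + 2 * deriv F t * q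
      - (2 * α + 2) * F t * q + R ^ 2 * F t * g2) +
      ((2 * deriv F t * (Z1 / T) + F t * (Z2 / T ^ 2) + 2 * s * (F t * (Z1 / T))) * g
        + 2 * (F t * (Z1 / T)) * q))))) ≤ 0 := by
    intro h1 h2
    rw [h1, h2]
    simp only [zero_div, mul_zero, zero_mul, add_zero]
    have : 0 ≤ v * (R ^ 2 * (R ^ (-κ) * (Zv * ((deriv (deriv F) t + 2 * s * deriv F t) * g + 2 * deriv F t * q
      - (2 * α + 2) * F t * q + R ^ 2 * F t * g2)))) := by positivity
    linarith
  by_cases hcs : t1 + T ≤ τ ∧ τ ≤ t1 + 2 * T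
  swap
  · refine (hcase0 ?_ ?_).trans (add_nonneg hpos1 hpos2)
    all_goals
      by_cases h : t / T ≤ 1
      · first
        | exact dZ _ h
        | exact ddZ _ h
      · have hh : 2 ≤ t / T := by
          rw [le_div_iff₀ hT0]
          rw [div_le_one hT0] at h
          by_contra h'
          exact hcs ⟨by linarith, by linarith⟩
        have h1 := hZd (t / T)
        have h2 := hZdd (t / T)
        rw [hZ2 _ hh, hp0', mul_zero] at h1 h2
        first
        | exact abs_nonpos_iff.1 h1
        | exact abs_nonpos_iff.1 h2
  · rw [if_pos hcs]
    obtain ⟨hF1a, hF1b, hF1c, hF1d⟩ := hF1 t (by linarith)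
    have hgR : g ≤ R := by
      refine le_trans ?_ hz
      rw [hg, gK_pos_eq K z hK hzK]
      have h1 : 0 < z - K := by linarith
      have h2 : Real.exp (-(4 * K) * (z - K)⁻¹) ≤ 1 := by
        rw [Real.exp_le_one_iff]
        have : 0 ≤ 4 * K * (z - K)⁻¹ := by positivity
        linarith
      have : 0 < z := by linarith
      nlinarith
    have hE := err_bound p s t T Zv Z1 Z2 (F t) (deriv F t) g q R C1 C2 Cq f0 hp hs hT
      (by linarith) (by linarith) (Real.exp_le_exp.2 (by linarith)) hZv0 hC1 hC2 hCq
      (hZd _) (hZdd _) hFt.le hF1b hF1t hF1c hF1d hg0 hgR hq0 (hq z hzK)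
    rw [← hM] at hE
    have hY := young_final n α κ p v (Zv * g) R T M f0 hp hβ hκ hv (by positivity) hR1 hT hM0 hf0
    have h1 : v * (-(R ^ 2 * (R ^ (-κ) * (Zv * ((deriv (deriv F) t + 2 * s * deriv F t) * g + 2 * deriv F t * q
      - (2 * α + 2) * F t * q + R ^ 2 * F t * g2) +
      ((2 * deriv F t * (Z1 / T) + F t * (Z2 / T ^ 2) + 2 * s * (F t * (Z1 / T))) * g
        + 2 * (F t * (Z1 / T)) * q))))) ≤ v * (R ^ 2 * R ^ (-κ) * (M * (Zv * g) ^ (1 / p) * R ^ (1 - 1 / p) / T)) := by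
      rw [show ∀ A : ℝ, -(R ^ 2 * (R ^ (-κ) * A)) = R ^ 2 * R ^ (-κ) * (-A) by intro A; ring]
      gcongr
      linarith
    refine h1.trans (hY.trans ?_)
    refine add_le_add ?_ le_rfl
    have : R ^ (-κ) * (f0 * (Zv * g)) ≤ R ^ (-κ) * PhiT F Z t1 T τ * g := by
      rw [PhiT, ← ht, ← hZv, mul_assoc, mul_assoc (F t)]
      gcongr
    gcongr


lemma exp_tauv {N : ℕ} (x : Euc N) (hx : x ≠ 0) : Real.exp (tauv x) = ‖x‖⁻¹ := by
  have h : 0 < ‖x‖ := norm_pos_iff.2 hx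
  rw [tauv, Real.log_pow, show -(1/2) * (((2:ℕ):ℝ) * Real.log ‖x‖) = -Real.log ‖x‖ by push_cast; ring,
    Real.exp_neg, Real.exp_log h]

lemma tauv_contDiffAt {N : ℕ} (x : Euc N) (hx : x ≠ 0) : ContDiffAt ℝ (⊤ : ℕ∞) (tauv : Euc N → ℝ) x := by
  have h : ‖x‖ ^ 2 ≠ 0 := by positivity
  unfold tauv
  exact contDiffAt_const.mul ((contDiff_norm_sq ℝ).contDiffAt.log h)

lemma zetv_contDiffAt {N : ℕ} (e x : Euc N) (hx : x ≠ 0) : ContDiffAt ℝ (⊤ : ℕ∞) (zetv e) x := by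
  have h : ‖x‖ ^ 2 ≠ 0 := by positivity
  unfold zetv
  exact (contDiffAt_id.inner ℝ contDiffAt_const).mul ((contDiff_norm_sq ℝ).contDiffAt.inv h)

lemma tauv_gt {N : ℕ} (x : Euc N) (hx : x ≠ 0) (a : ℝ) : a < tauv x ↔ ‖x‖ < Real.exp (-a) := by
  have h : 0 < ‖x‖ := norm_pos_iff.2 hx
  rw [← Real.exp_lt_exp, exp_tauv x hx, Real.exp_neg, lt_inv_comm₀ (Real.exp_pos _) h]

lemma tauv_lt {N : ℕ} (x : Euc N) (hx : x ≠ 0) (a : ℝ) : tauv x < a ↔ Real.exp (-a) < ‖x‖ := by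
  have h : 0 < ‖x‖ := norm_pos_iff.2 hx
  rw [← Real.exp_lt_exp, exp_tauv x hx, Real.exp_neg, inv_lt_comm₀ h (Real.exp_pos _)]

lemma PhiT_hasDerivAt (F Z : ℝ → ℝ) (t1 T τ : ℝ) (hF : ContDiff ℝ (⊤ : ℕ∞) F) (hZ : ContDiff ℝ (⊤ : ℕ∞) Z) :
    HasDerivAt (PhiT F Z t1 T) (PhiT1 F Z t1 T τ) τ ∧ HasDerivAt (PhiT1 F Z t1 T) (PhiT2 F Z t1 T τ) τ := by
  have hFd : Differentiable ℝ F := hF.differentiable (by simp)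
  have hFdd : Differentiable ℝ (deriv F) := (hF.iterate_deriv 1).differentiable (by simp)
  have hZdf : Differentiable ℝ Z := hZ.differentiable (by simp)
  have hZddf : Differentiable ℝ (deriv Z) := (hZ.iterate_deriv 1).differentiable (by simp)
  have a1 : HasDerivAt (fun τ => τ - t1) 1 τ := (hasDerivAt_id τ).sub_const t1
  have a2 : HasDerivAt (fun τ => (τ - t1) / T) (1 / T) τ := a1.div_const T
  have f0 : HasDerivAt (fun τ => F (τ - t1)) (deriv F (τ - t1) * 1) τ := (hFd (τ - t1)).hasDerivAt.comp τ a1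
  have f1 : HasDerivAt (fun τ => deriv F (τ - t1)) (deriv (deriv F) (τ - t1) * 1) τ :=
    HasDerivAt.comp (h₂ := deriv F) τ (hFdd (τ - t1)).hasDerivAt a1
  have z0 : HasDerivAt (fun τ => Z ((τ - t1) / T)) (deriv Z ((τ - t1) / T) * (1 / T)) τ := (hZdf _).hasDerivAt.comp τ a2
  have z1 : HasDerivAt (fun τ => deriv Z ((τ - t1) / T)) (deriv (deriv Z) ((τ - t1) / T) * (1 / T)) τ :=
    HasDerivAt.comp (h₂ := deriv Z) τ (hZddf _).hasDerivAt a2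
  constructor
  · refine (f0.mul z0).congr_deriv ?_
    rw [PhiT1]; ring
  · refine ((f1.mul z0).add (f0.mul (z1.div_const T))).congr_deriv ?_
    rw [PhiT2]; ring

lemma test_fun {N : ℕ} (α c s p K : ℝ) (hp : 1 < p) (hβ : 1 / (p - 1) ≤ α / 2) (hs : 0 ≤ s)
    (hsα : s = ((N : ℝ) - 2) / 2 - α) (hroot : α ^ 2 - ((N : ℝ) - 2) * α + c - N + 1 = 0)
    (hK : 1 ≤ K) (hα : 0 < α) (e : Euc N) (he : ‖e‖ = 1) :
    ∃ (t1 C : ℝ) (φi : Euc N → ℝ), 0 ≤ t1 ∧ 0 ≤ C ∧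
      (∀ x, t1 < tauv x → K < zetv e x → 0 < φi x) ∧
      ∀ T, 1 ≤ T → ∃ φ : Euc N → ℝ, ContDiff ℝ (⊤ : ℕ∞) φ ∧ (∀ x, 0 ≤ φ x) ∧
        (∀ x, φ x ≠ 0 → x ≠ 0 ∧ t1 < tauv x ∧ tauv x < t1 + 2 * T ∧ K < zetv e x) ∧
        (∀ x, tauv x ≤ t1 + T → φ x = φi x) ∧
        ∀ x, x ≠ 0 → ∀ v, 0 ≤ v → v * (-(lap φ x) - c * (‖x‖ ^ 2)⁻¹ * φ x) ≤
          1 / 2 * v ^ p * φ x + C * T ^ (-(1 + 1 / (p - 1))) *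
            (if t1 + T ≤ tauv x ∧ tauv x ≤ t1 + 2 * T then (‖x‖ ^ N)⁻¹ else 0) := by
  set κ := α + 3 - (N : ℝ) with hκ
  obtain ⟨t1, C, F, Z, ht1, hC, hFs, hZs, hF0, hFp, hZ0, hZ1, hZ2, hmain⟩ :=
    test_scalar N α κ s p K hp hβ hs hκ hK hα
  have hgs := gK_contDiff K
  have hgd : Differentiable ℝ (gK K) := hgs.differentiable (by simp)
  have hgdd : Differentiable ℝ (deriv (gK K)) := (hgs.iterate_deriv 1).differentiable (by simp)
  have hFnn : ∀ t, 0 ≤ F t := by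
    intro t
    rcases le_or_gt t 0 with h | h
    · rw [hF0 _ h]
    · exact (hFp _ h).le
  refine ⟨t1, C, fun x => Real.exp (-κ * tauv x) * F (tauv x - t1) * gK K (zetv e x), ht1, hC, ?_, ?_⟩
  · intro x h1 h2
    have := hFp (tauv x - t1) (by linarith)
    have h3 : 0 < gK K (zetv e x) := by
      rw [gK_pos_eq K _ hK h2]; have : 0 < zetv e x := by linarith
      positivity
    positivity
  intro T hT
  have hT0 : 0 < T := by linarith
  have hne : ∀ x, Real.exp (-κ * tauv x) * PhiT F Z t1 T (tauv x) * gK K (zetv e x) ≠ 0 →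
      x ≠ 0 ∧ t1 < tauv x ∧ tauv x < t1 + 2 * T ∧ K < zetv e x := by
    intro x hx
    have hz : K < zetv e x := by
      by_contra h
      exact hx (by rw [gK_zero K _ hK (not_lt.1 h), mul_zero])
    refine ⟨?_, ?_, ?_, hz⟩
    · rintro rfl
      simp [zetv] at hz; linarith
    · by_contra h
      exact hx (by rw [PhiT, hF0 _ (by linarith)]; ring)
    · by_contra h
      exact hx (by rw [PhiT, hZ2 _ (by rw [le_div_iff₀ hT0]; linarith)]; ring)
  refine ⟨fun x => Real.exp (-κ * tauv x) * PhiT F Z t1 T (tauv x) * gK K (zetv e x), ?_, ?_, hne, ?_, ?_⟩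
  · rw [contDiff_iff_contDiffAt]
    intro x
    by_cases hx : x = 0
    · subst hx
      have : (fun x : Euc N => Real.exp (-κ * tauv x) * PhiT F Z t1 T (tauv x) * gK K (zetv e x)) =ᶠ[𝓝 0]
          fun _ => 0 := by
        filter_upwards [Metric.ball_mem_nhds (0 : Euc N) (Real.exp_pos (-(t1 + 2 * T)))] with y hy
        by_contra h
        obtain ⟨h1, -, h2, -⟩ := hne y h
        rw [tauv_lt y h1] at h2
        rw [mem_ball_zero_iff] at hy
        linarith
      exact contDiffAt_const.congr_of_eventuallyEq this
    · have ht := tauv_contDiffAt x hx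
      have hz := zetv_contDiffAt e x hx
      unfold PhiT
      refine ContDiffAt.mul (ContDiffAt.mul (contDiffAt_const.mul ht).exp (ContDiffAt.mul ?_ ?_)) ?_
      · exact hFs.contDiffAt.comp x (ht.sub contDiffAt_const)
      · exact hZs.contDiffAt.comp x ((ht.sub contDiffAt_const).div_const _)
      · exact hgs.contDiffAt.comp x hz
  · intro x
    have := gK_nonneg K (zetv e x) hK
    have := hZ0 ((tauv x - t1) / T)
    have := hFnn (tauv x - t1)
    simp only [PhiT]; positivity
  · intro x hx
    simp only [PhiT]
    rw [hZ1 _ (by rw [div_le_one hT0]; linarith), mul_one]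
  · intro x hx v hv
    have hn : 0 < ‖x‖ := norm_pos_iff.2 hx
    have hR := exp_tauv x hx
    have hzR : zetv e x ≤ Real.exp (tauv x) := by
      rw [hR, zetv]
      have := real_inner_le_norm x e
      rw [he, mul_one] at this
      rw [← div_eq_mul_inv, div_le_iff₀ (by positivity)]
      refine this.trans (le_of_eq ?_)
      field_simp
    have hm := hmain T hT (tauv x) (zetv e x) v hzR hv
    have hlap := lap_GG e he (fun t => Real.exp (-κ * t) * PhiT F Z t1 T t)
      (fun t => Real.exp (-κ * t) * (PhiT1 F Z t1 T t - κ * PhiT F Z t1 T t))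
      (fun t => Real.exp (-κ * t) * (PhiT2 F Z t1 T t - 2 * κ * PhiT1 F Z t1 T t + κ ^ 2 * PhiT F Z t1 T t))
      (gK K) (deriv (gK K)) (deriv (deriv (gK K))) ?_ ?_ (fun t => (hgd t).hasDerivAt)
      (fun t => (hgdd t).hasDerivAt) x hx
    rotate_left
    · intro t
      have h1 : HasDerivAt (fun t => Real.exp (-κ * t)) (Real.exp (-κ * t) * (-κ * 1)) t :=
        ((hasDerivAt_id t).const_mul (-κ)).exp
      refine (h1.mul (PhiT_hasDerivAt F Z t1 T t hFs hZs).1).congr_deriv ?_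
      ring
    · intro t
      have h1 : HasDerivAt (fun t => Real.exp (-κ * t)) (Real.exp (-κ * t) * (-κ * 1)) t :=
        ((hasDerivAt_id t).const_mul (-κ)).exp
      have h2 := PhiT_hasDerivAt F Z t1 T t hFs hZs
      refine (h1.mul (h2.2.sub (h2.1.const_mul κ))).congr_deriv ?_
      simp only [Pi.sub_apply]
      ring
    have hR2 : Real.exp (tauv x) ^ 2 = (‖x‖ ^ 2)⁻¹ := by rw [hR, inv_pow]
    have hRN : Real.exp (tauv x) ^ (N : ℝ) = (‖x‖ ^ N)⁻¹ := by rw [hR, Real.rpow_natCast, inv_pow]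
    rw [hRN, hR2] at hm
    refine le_trans (le_of_eq ?_) hm
    rw [hlap, ← radial_id N α c κ s _ _ _ _ _ _ _ _ _ hroot hκ hsα]
    ring


lemma zetv_le_iff {N : ℕ} (e x : Euc N) (hx : x ≠ 0) (K : ℝ) : K ≤ zetv e x ↔ K * ‖x‖ ^ 2 ≤ ⟪x, e⟫ := by
  have h : 0 < ‖x‖ ^ 2 := by positivity
  rw [zetv, ← div_eq_mul_inv, le_div_iff₀ h]

lemma geom {N : ℕ} {Ω : Set (Euc N)} (hΩ : IsSmoothDomain Ω) (h0 : (0 : Euc N) ∈ frontier Ω) :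
    ∃ (e : Euc N) (K : ℝ), ‖e‖ = 1 ∧ 1 ≤ K ∧ ∀ x, x ≠ 0 → K ≤ zetv e x → x ∈ Ω := by
  obtain ⟨-, -, -, h⟩ := hΩ
  obtain ⟨U, f, hU, h0U, hf, hdf, hΩU, hfU⟩ := h 0 h0
  have hf0 : f 0 = 0 := by
    have : (0 : Euc N) ∈ frontier Ω ∩ U := ⟨h0, h0U⟩
    rw [hfU] at this; exact this.2
  have hd0 := hdf 0 h0U
  set a : Euc N := (InnerProductSpace.toDual ℝ (Euc N)).symm (fderiv ℝ f 0) with ha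
  have hax : ∀ x, fderiv ℝ f 0 x = ⟪a, x⟫ := by
    intro x; rw [ha, InnerProductSpace.toDual_symm_apply]
  have ha0 : a ≠ 0 := by
    rw [ha]; simpa using hd0
  have han : 0 < ‖a‖ := norm_pos_iff.2 ha0
  have hfd : Differentiable ℝ f := hf.differentiable (by simp)
  have hfdd : DifferentiableAt ℝ (fderiv ℝ f) 0 :=
    (contDiff_infty_iff_fderiv.1 hf).2.differentiable (by simp) 0
  obtain ⟨M, hM⟩ := hfdd.hasFDerivAt.isBigO_sub.bound
  obtain ⟨δ, hδ, hδU⟩ := Metric.eventually_nhds_iff_ball.1 (hM.and (hU.mem_nhds h0U))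
  have taylor : ∀ x, ‖x‖ < δ → f x ≤ ⟪a, x⟫ + M * ‖x‖ ^ 2 := by
    intro x hx
    have hsub : ∀ y ∈ closedBall (0 : Euc N) ‖x‖, ‖fderiv ℝ f y - fderiv ℝ f 0‖ ≤ M * ‖x‖ := by
      intro y hy
      rw [mem_closedBall_zero_iff] at hy
      have h1 := (hδU y (by rw [mem_ball_zero_iff]; linarith)).1
      rw [sub_zero] at h1
      rcases (norm_nonneg y).eq_or_lt with hy0 | hy0
      · rw [← hy0] at h1
        by_cases hx0 : ‖x‖ = 0
        · rw [hx0]; exact h1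
        · have hx1 : 0 < ‖x‖ := lt_of_le_of_ne (norm_nonneg x) (Ne.symm hx0)
          have h2 := (hδU x (by rw [mem_ball_zero_iff]; linarith)).1
          rw [sub_zero] at h2
          have := (norm_nonneg _).trans h2
          linarith
      · have hM0 : 0 ≤ M := by
          have := (norm_nonneg _).trans h1
          by_contra hh
          nlinarith
        exact h1.trans (by gcongr)
    have := (convex_closedBall (0 : Euc N) ‖x‖).norm_image_sub_le_of_norm_fderiv_le'
      (fun y _ => hfd y) hsub (x := 0) (y := x) (by simp) (by simp)
    rw [hf0, sub_zero, sub_zero, hax, Real.norm_eq_abs] at this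
    have := (abs_le.1 this).2
    nlinarith
  refine ⟨-((‖a‖⁻¹) • a), max 1 (max (M / ‖a‖ + 1) (2 / δ)), ?_, le_max_left _ _, ?_⟩
  · rw [norm_neg, norm_smul, norm_inv, norm_norm, inv_mul_cancel₀ han.ne']
  intro x hx hK
  have hn : 0 < ‖x‖ := norm_pos_iff.2 hx
  rw [zetv_le_iff _ x hx, inner_neg_right, inner_smul_right, real_inner_comm] at hK
  set K := max 1 (max (M / ‖a‖ + 1) (2 / δ)) with hKd
  have hK1 : M / ‖a‖ + 1 ≤ K := (le_max_left _ _).trans (le_max_right _ _)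
  have hK2 : 2 / δ ≤ K := (le_max_right _ _).trans (le_max_right _ _)
  have hK3 : K * ‖x‖ ^ 2 * ‖a‖ ≤ -⟪a, x⟫ := by
    have := mul_le_mul_of_nonneg_right hK han.le
    refine this.trans (le_of_eq ?_)
    field_simp
  have hcs := (abs_le.1 (abs_real_inner_le_norm a x)).1
  have hxK : K * ‖x‖ ≤ 1 := by
    have : K * ‖x‖ * (‖x‖ * ‖a‖) ≤ 1 * (‖x‖ * ‖a‖) := by nlinarith
    exact le_of_mul_le_mul_right this (by positivity)
  have hxδ : ‖x‖ < δ := by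
    have : 2 / δ * ‖x‖ ≤ 1 := le_trans (by gcongr) hxK
    rw [div_mul_eq_mul_div, div_le_one hδ] at this
    linarith
  have hfx : f x < 0 := by
    have h1 := taylor x hxδ
    have h2 : (M / ‖a‖ + 1) * ‖a‖ * ‖x‖ ^ 2 ≤ K * ‖a‖ * ‖x‖ ^ 2 := by gcongr
    have h3 : (M / ‖a‖ + 1) * ‖a‖ = M + ‖a‖ := by field_simp
    rw [h3] at h2
    have : 0 < ‖a‖ * ‖x‖ ^ 2 := by positivity
    nlinarith
  have : x ∈ Ω ∩ U := by
    rw [hΩU]; exact ⟨(hδU x (by rwa [mem_ball_zero_iff])).2, hfx⟩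
  exact this.1


lemma annulus {N : ℕ} (hN : 1 ≤ N) (a b : ℝ) (ha : 0 < a) (hab : a ≤ b) :
    Integrable (fun x : Euc N => Set.indicator (Set.Icc a b) (fun y => (y ^ N)⁻¹) ‖x‖) ∧
    ∫ x : Euc N, Set.indicator (Set.Icc a b) (fun y => (y ^ N)⁻¹) ‖x‖ =
      N * volume.real (ball (0 : Euc N) 1) * Real.log (b / a) := by
  haveI : Nonempty (Fin N) := ⟨⟨0, hN⟩⟩
  haveI : Nontrivial (Euc N) := inferInstance
  have key : ∀ y : ℝ, y ^ (N - 1) • Set.indicator (Set.Icc a b) (fun y => (y ^ N)⁻¹) y =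
      Set.indicator (Set.Icc a b) (fun y => y⁻¹) y := by
    intro y
    by_cases hy : y ∈ Set.Icc a b
    · rw [Set.indicator_of_mem hy, Set.indicator_of_mem hy]
      have : 0 < y := ha.trans_le hy.1
      obtain ⟨M, rfl⟩ : ∃ M, N = M + 1 := ⟨N - 1, by omega⟩
      simp only [smul_eq_mul, Nat.add_sub_cancel]
      field_simp
      rw [pow_succ]
    · rw [Set.indicator_of_notMem hy, Set.indicator_of_notMem hy]; simp
  have hsub : Set.Icc a b ⊆ Set.Ioi 0 := fun y hy => ha.trans_le hy.1
  constructor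
  · rw [integrable_fun_norm_addHaar volume (f := Set.indicator (Set.Icc a b) (fun y => (y ^ N)⁻¹))]
    simp only [finrank_euclideanSpace, Fintype.card_fin, key]
    apply Integrable.integrableOn
    rw [integrable_indicator_iff measurableSet_Icc]
    apply ContinuousOn.integrableOn_Icc
    exact continuousOn_id.inv₀ (fun y hy => (hsub hy).ne')
  · rw [integral_fun_norm_addHaar volume (Set.indicator (Set.Icc a b) (fun y => (y ^ N)⁻¹))]
    simp only [finrank_euclideanSpace, Fintype.card_fin, key]
    rw [setIntegral_indicator measurableSet_Icc, Set.inter_eq_self_of_subset_right hsub,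
      integral_Icc_eq_integral_Ioc, ← intervalIntegral.integral_of_le hab, integral_inv_of_pos ha (ha.trans_le hab)]
    simp; ring

lemma integ_mul {N : ℕ} {Ω k : Set (Euc N)} {w h : Euc N → ℝ} (hw : LocallyIntegrableOn w Ω volume)
    (hh : Continuous h) (hk : IsCompact k) (hkΩ : k ⊆ Ω) (hz : ∀ x, x ∉ k → h x = 0) :
    IntegrableOn (fun x => w x * h x) Ω volume := by
  have h1 : IntegrableOn w k volume := hw.integrableOn_compact_subset hkΩ hk
  have h2 : IntegrableOn (fun x => w x * h x) k volume := h1.mul_continuousOn hh.continuousOn hk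
  have h3 : Integrable (fun x => w x * h x) volume := by
    rw [← integrableOn_iff_integrable_of_support_subset (s := k)]
    · exact h2
    · intro x hx
      by_contra hxk
      exact hx (by simp [hz x hxk])
  exact h3.integrableOn

lemma lap_continuous {N : ℕ} {φ : Euc N → ℝ} (h : ContDiff ℝ (⊤ : ℕ∞) φ) : Continuous (lap φ) := by
  unfold lap
  refine continuous_finset_sum _ fun i _ => ?_
  have h2 : ContDiff ℝ 2 φ := contDiff_infty.1 h 2
  have := h2.continuous_iteratedFDeriv (m := 2) le_rfl
  exact (ContinuousMultilinearMap.apply ℝ (fun _ : Fin 2 => Euc N) ℝ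
    ![EuclideanSpace.single i 1, EuclideanSpace.single i 1]).continuous.comp this

lemma lap_zero_off {N : ℕ} {φ : Euc N → ℝ} {x : Euc N} (h : x ∉ tsupport φ) : lap φ x = 0 := by
  unfold lap
  have : iteratedFDeriv ℝ 2 φ x = 0 := by
    by_contra hh
    exact h (support_iteratedFDeriv_subset 2 hh)
  simp [this]


lemma params (N : ℕ) (hN : 3 ≤ N) (c p : ℝ) (hc1 : (N : ℝ) - 1 < c)
    (hp : 1 + 2 / (((N : ℝ) - 2) / 2 - Real.sqrt ((N : ℝ) ^ 2 / 4 - c)) ≤ p) :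
    ∃ α c' s : ℝ, c' ≤ c ∧ 1 < p ∧ 1 / (p - 1) ≤ α / 2 ∧ 0 ≤ s ∧ s = ((N : ℝ) - 2) / 2 - α ∧
      α ^ 2 - ((N : ℝ) - 2) * α + c' - N + 1 = 0 ∧ 0 < α := by
  have hN' : (3 : ℝ) ≤ N := by exact_mod_cast hN
  set s := Real.sqrt ((N : ℝ) ^ 2 / 4 - c) with hs
  have hs0 : 0 ≤ s := Real.sqrt_nonneg _
  have hsq : s ^ 2 = (N : ℝ) ^ 2 / 4 - min c ((N : ℝ) ^ 2 / 4) := by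
    rcases le_total c ((N : ℝ) ^ 2 / 4) with h | h
    · rw [min_eq_left h, hs, Real.sq_sqrt (by linarith)]
    · rw [min_eq_right h, hs, Real.sqrt_eq_zero_of_nonpos (by linarith)]; ring
  have hc' : (N : ℝ) - 1 < min c ((N : ℝ) ^ 2 / 4) := by
    apply lt_min hc1; nlinarith
  set α := ((N : ℝ) - 2) / 2 - s with hα
  have hα0 : 0 < α := by
    have : s < ((N : ℝ) - 2) / 2 := by
      apply lt_of_pow_lt_pow_left₀ 2 (by linarith)
      rw [hsq]; nlinarith
    linarith
  have hp1 : 2 / α ≤ p - 1 := by linarith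
  have h2 : 0 < 2 / α := by positivity
  refine ⟨α, min c ((N : ℝ) ^ 2 / 4), s, min_le_left _ _, by linarith, ?_, hs0, by linarith, ?_, hα0⟩
  · rw [div_le_div_iff₀ (by linarith) (by norm_num)]
    rw [div_le_iff₀ hα0] at hp1
    linarith
  · have : s = ((N : ℝ) - 2) / 2 - α := by linarith
    rw [this] at hsq
    linarith

lemma super_ineq {N : ℕ} {Ω : Set (Euc N)} (c p : ℝ) (u φ h : Euc N → ℝ) (hΩo : IsOpen Ω)
    (hu0 : ∀ᵐ x ∂volume, x ∈ Ω → 0 ≤ u x)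
    (huloc : LocallyIntegrableOn u (Ω) volume)
    (hup : LocallyIntegrableOn (fun x => u x ^ p) (Ω) volume)
    (hbu : LocallyIntegrableOn (fun x => c * ‖x‖ ^ (-2 : ℝ) * u x) (Ω) volume)
    (hφ : IsTestFun Ω φ) (hφ0 : ∀ x, 0 ≤ φ x)
    (hsuper : ∫ x in Ω, u x ^ p * φ x ≤
        ∫ x in Ω, u x * (-(lap φ x) - c * ‖x‖ ^ (-2 : ℝ) * φ x))
    (hh : Integrable h)
    (hpt : ∀ᵐ x ∂volume, x ∈ Ω → 0 ≤ u x → u x * (-(lap φ x) - c * (‖x‖ ^ 2)⁻¹ * φ x) ≤ 1 / 2 * (u x) ^ p * φ x + h x) :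
    IntegrableOn (fun x => u x ^ p * φ x) Ω ∧ ∫ x in Ω, u x ^ p * φ x ≤ 2 * ∫ x in Ω, h x := by
  have i1 : IntegrableOn (fun x => u x ^ p * φ x) Ω :=
    integ_mul hup hφ.1.continuous hφ.2.1 hφ.2.2 (fun x hx => image_eq_zero_of_notMem_tsupport hx)
  have i2 : IntegrableOn (fun x => u x * lap φ x) Ω :=
    integ_mul huloc (lap_continuous hφ.1) hφ.2.1 hφ.2.2 (fun x hx => lap_zero_off hx)
  have i3 : IntegrableOn (fun x => c * ‖x‖ ^ (-2 : ℝ) * u x * φ x) Ω :=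
    integ_mul hbu hφ.1.continuous hφ.2.1 hφ.2.2 (fun x hx => image_eq_zero_of_notMem_tsupport hx)
  have i4 : IntegrableOn (fun x => u x * (-(lap φ x) - c * ‖x‖ ^ (-2 : ℝ) * φ x)) Ω := by
    have := (i2.add i3).neg
    refine this.congr (Eventually.of_forall fun x => ?_)
    simp only [Pi.neg_apply, Pi.add_apply]; ring
  refine ⟨i1, ?_⟩
  have h1 : ∫ x in Ω, u x * (-(lap φ x) - c * ‖x‖ ^ (-2 : ℝ) * φ x) ≤
      ∫ x in Ω, (1 / 2 * (u x ^ p * φ x) + h x) := by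
    apply integral_mono_ae i4 ((i1.const_mul _).add hh.integrableOn)
    rw [Filter.EventuallyLE, ae_restrict_iff' hΩo.measurableSet]
    filter_upwards [hu0, hpt] with x hx hptx hxΩ
    have h2 : ‖x‖ ^ (-2 : ℝ) = (‖x‖ ^ 2)⁻¹ := by rw [Real.rpow_neg (norm_nonneg _), Real.rpow_two]
    rw [h2]
    have := hptx hxΩ (hx hxΩ)
    simp only [Pi.add_apply]
    linarith
  rw [integral_add (i1.const_mul _) hh.integrableOn, integral_const_mul] at h1
  linarith


lemma initial_zero {N : ℕ} (hN : 3 ≤ N) (Ω : Set (Euc N))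
    (hΩ : IsSmoothDomain Ω) (h0 : (0 : Euc N) ∈ frontier Ω)
    (c p : ℝ) (hc1 : (N : ℝ) - 1 < c)
    (hp : 1 + 2 / (((N : ℝ) - 2) / 2 - Real.sqrt ((N : ℝ) ^ 2 / 4 - c)) ≤ p)
    (u : Euc N → ℝ)
    (hu0 : ∀ᵐ x ∂volume, x ∈ Ω → 0 ≤ u x)
    (huloc : LocallyIntegrableOn u (Ω) volume)
    (hup : LocallyIntegrableOn (fun x => u x ^ p) (Ω) volume)
    (hbu : LocallyIntegrableOn (fun x => c * ‖x‖ ^ (-2 : ℝ) * u x) (Ω) volume)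
    (hsuper : ∀ φ : Euc N → ℝ, IsTestFun (Ω) φ → (∀ x, 0 ≤ φ x) →
      ∫ x in Ω, u x ^ p * φ x ≤
        ∫ x in Ω, u x * (-(lap φ x) - c * ‖x‖ ^ (-2 : ℝ) * φ x)) :
    ∃ V : Set (Euc N), IsOpen V ∧ V.Nonempty ∧ V ⊆ Ω ∧ ∀ᵐ x ∂volume, x ∈ V → u x = 0 := by
  obtain ⟨α, c', s, hc', hp1, hβ, hs, hsα, hroot, hα⟩ := params N hN c p hc1 hp
  obtain ⟨e, K, he, hK, hKΩ⟩ := geom hΩ h0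
  obtain ⟨t1, C, φi, ht1, hC, hφi, htest⟩ := test_fun α c' s p K hp1 hβ hs hsα hroot hK hα e he
  have hΩo := hΩ.1
  have hcon1 : Continuous fun x : Euc N => K * ‖x‖ ^ 2 := by fun_prop
  have hcon2 : Continuous fun x : Euc N => ⟪x, e⟫ := by fun_prop
  have h0Ω : (0 : Euc N) ∉ Ω := by
    intro h
    have : (0 : Euc N) ∈ Ω ∩ frontier Ω := ⟨h, h0⟩
    rw [hΩo.inter_frontier_eq] at this
    exact this
  have hp0 : 0 < p := by linarith
  set β := 1 / (p - 1) with hβd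
  have hβ0 : 0 < β := by rw [hβd]; apply one_div_pos.2; linarith
  set C' : ℝ := 2 * (C * (N * volume.real (ball (0 : Euc N) 1))) with hC'
  have hbound : ∀ T, 1 ≤ T → ∃ φ : Euc N → ℝ, (∀ x, 0 ≤ φ x) ∧ (∀ x, tauv x ≤ t1 + T → φ x = φi x) ∧
      IntegrableOn (fun x => u x ^ p * φ x) Ω ∧ ∫ x in Ω, u x ^ p * φ x ≤ C' * T ^ (-β) := by
    intro T hT
    have hT0 : 0 < T := by linarith
    obtain ⟨φ, hφs, hφ0, hφne, hφeq, hφl⟩ := htest T hT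
    set S : Set (Euc N) := {x | Real.exp (-(t1 + 2 * T)) ≤ ‖x‖ ∧ ‖x‖ ≤ Real.exp (-t1) ∧ K * ‖x‖ ^ 2 ≤ ⟪x, e⟫} with hS
    have hSc : IsClosed S := by
      refine (isClosed_le continuous_const continuous_norm).inter
        ((isClosed_le continuous_norm continuous_const).inter (isClosed_le hcon1 hcon2))
    have hSk : IsCompact S := by
      apply Metric.isCompact_of_isClosed_isBounded hSc
      apply (isBounded_closedBall (x := (0 : Euc N)) (r := Real.exp (-t1))).subset
      intro x hx
      rw [mem_closedBall_zero_iff]; exact hx.2.1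
    have hsupp : tsupport φ ⊆ S := by
      apply closure_minimal _ hSc
      intro x hx
      obtain ⟨h1, h2, h3, h4⟩ := hφne x hx
      exact ⟨((tauv_lt x h1 _).1 h3).le, ((tauv_gt x h1 _).1 h2).le, (zetv_le_iff e x h1 K).1 h4.le⟩
    have hSΩ : S ⊆ Ω := by
      intro x hx
      have hx0 : x ≠ 0 := norm_pos_iff.1 ((Real.exp_pos _).trans_le hx.1)
      exact hKΩ x hx0 ((zetv_le_iff e x hx0 K).2 hx.2.2)
    have htf : IsTestFun Ω φ := ⟨hφs, hSk.of_isClosed_subset (isClosed_tsupport φ) hsupp, hsupp.trans hSΩ⟩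
    obtain ⟨an1, an2⟩ := annulus (N := N) (by omega) (Real.exp (-(t1 + 2 * T))) (Real.exp (-(t1 + T)))
      (Real.exp_pos _) (Real.exp_le_exp.2 (by linarith))
    rw [← Real.exp_sub, Real.log_exp, show -(t1 + T) - -(t1 + 2 * T) = T by ring] at an2
    set ind : Euc N → ℝ := fun x => Set.indicator (Set.Icc (Real.exp (-(t1 + 2 * T))) (Real.exp (-(t1 + T))))
      (fun y => (y ^ N)⁻¹) ‖x‖ with hind
    have hCT : 0 ≤ C * T ^ (-(1 + β)) := by positivity
    have hpt : ∀ x ∈ Ω, 0 ≤ u x → u x * (-(lap φ x) - c * (‖x‖ ^ 2)⁻¹ * φ x) ≤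
        1 / 2 * (u x) ^ p * φ x + C * T ^ (-(1 + β)) * ind x := by
      intro x hxΩ hux
      have hx0 : x ≠ 0 := by rintro rfl; exact h0Ω hxΩ
      have h1 := hφl x hx0 (u x) hux
      have h2 : (if t1 + T ≤ tauv x ∧ tauv x ≤ t1 + 2 * T then (‖x‖ ^ N)⁻¹ else 0) = ind x := by
        simp only [hind, Set.indicator]
        congr 1
        rw [Set.mem_Icc, ← not_lt, ← not_lt, tauv_lt x hx0, tauv_gt x hx0, not_lt, not_lt, and_comm]
      rw [h2] at h1
      refine le_trans ?_ h1
      have h3 : 0 ≤ (‖x‖ ^ 2)⁻¹ * φ x := mul_nonneg (by positivity) (hφ0 x)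
      have h4 : c' * ((‖x‖ ^ 2)⁻¹ * φ x) ≤ c * ((‖x‖ ^ 2)⁻¹ * φ x) := by gcongr
      apply mul_le_mul_of_nonneg_left _ hux
      linarith
    obtain ⟨i1, i2⟩ := super_ineq c p u φ (fun x => C * T ^ (-(1 + β)) * ind x) hΩo hu0 huloc hup hbu htf hφ0
      (hsuper φ htf hφ0) (an1.const_mul _) (Eventually.of_forall hpt)
    · refine ⟨φ, hφ0, hφeq, i1, i2.trans ?_⟩
      have : ∫ x in Ω, C * T ^ (-(1 + β)) * ind x ≤ ∫ x, C * T ^ (-(1 + β)) * ind x := by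
        apply setIntegral_le_integral (an1.const_mul _)
        refine Eventually.of_forall fun x => ?_
        refine mul_nonneg hCT ?_
        simp only [hind]
        apply Set.indicator_nonneg
        intro y hy
        have : 0 < y := (Real.exp_pos _).trans_le hy.1
        positivity
      rw [integral_const_mul (μ := volume), an2] at this
      have hTT : T ^ (-(1 + β)) * T = T ^ (-β) := by
        rw [← Real.rpow_add_one hT0.ne']; congr 1; ring
      calc 2 * ∫ x in Ω, C * T ^ (-(1 + β)) * ind x ≤
          2 * (C * T ^ (-(1 + β)) * (N * volume.real (ball (0 : Euc N) 1) * T)) := by gcongr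
        _ = C' * (T ^ (-(1 + β)) * T) := by rw [hC']; ring
        _ = _ := by rw [hTT]
  set T0 := K + 1 with hT0
  set V : Set (Euc N) := {x | x ≠ 0 ∧ Real.exp (-(t1 + T0)) < ‖x‖ ∧ ‖x‖ < Real.exp (-t1) ∧ K * ‖x‖ ^ 2 < ⟪x, e⟫} with hV
  have hVo : IsOpen V := by
    refine isOpen_ne.inter ((isOpen_lt continuous_const continuous_norm).inter
        ((isOpen_lt continuous_norm continuous_const).inter (isOpen_lt hcon1 hcon2)))
  have hVΩ : V ⊆ Ω := fun x hx => hKΩ x hx.1 ((zetv_le_iff e x hx.1 K).2 hx.2.2.2.le)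
  have hVt : ∀ x ∈ V, t1 < tauv x ∧ tauv x < t1 + T0 ∧ K < zetv e x := by
    intro x hx
    refine ⟨(tauv_gt x hx.1 _).2 hx.2.2.1, (tauv_lt x hx.1 _).2 hx.2.1, ?_⟩
    have h : 0 < ‖x‖ ^ 2 := by have := norm_pos_iff.2 hx.1; positivity
    rw [zetv, ← div_eq_mul_inv, lt_div_iff₀ h]; exact hx.2.2.2
  refine ⟨V, hVo, ?_, hVΩ, ?_⟩
  · set r := Real.exp (-(t1 + T0 - 1 / 2)) with hr
    have hr0 : 0 < r := Real.exp_pos _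
    have hn : ‖r • e‖ = r := by rw [norm_smul, he, mul_one, Real.norm_of_nonneg hr0.le]
    refine ⟨r • e, norm_pos_iff.1 (by rw [hn]; exact hr0), ?_, ?_, ?_⟩
    · rw [hn]; exact Real.exp_lt_exp.2 (by linarith)
    · rw [hn]; exact Real.exp_lt_exp.2 (by linarith)
    · rw [hn, inner_smul_left, real_inner_self_eq_norm_sq, he]
      simp only [conj_trivial, one_pow, mul_one]
      have h1 : K * r < 1 := by
        have h2 := Real.add_one_le_exp (t1 + T0 - 1 / 2)
        have h3 : Real.exp (t1 + T0 - 1 / 2) * r = 1 := by rw [hr, ← Real.exp_add]; simp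
        have h4 : K < Real.exp (t1 + T0 - 1 / 2) := by linarith
        rw [← h3]; gcongr
      nlinarith
  · obtain ⟨φ0, -, hφ0eq, hφ0i, -⟩ := hbound T0 (by linarith)
    have hφiV : ∀ x ∈ V, φ0 x = φi x := fun x hx => hφ0eq x (hVt x hx).2.1.le
    have hiV : IntegrableOn (fun x => u x ^ p * φi x) V := by
      refine (hφ0i.mono_set hVΩ).congr_fun (fun x hx => ?_) hVo.measurableSet
      simp only [hφiV x hx]
    have hle : ∀ T, T0 ≤ T → ∫ x in V, u x ^ p * φi x ≤ C' * T ^ (-β) := by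
      intro T hT
      obtain ⟨φ, hφ0, hφeq, hi, hb⟩ := hbound T (by linarith)
      refine le_trans ?_ hb
      have : ∫ x in V, u x ^ p * φi x = ∫ x in V, u x ^ p * φ x := by
        apply setIntegral_congr_fun hVo.measurableSet
        intro x hx
        simp only
        rw [hφeq x (by have := (hVt x hx).2.1; linarith)]
      rw [this]
      apply setIntegral_mono_set hi
      · rw [Filter.EventuallyLE, ae_restrict_iff' hΩo.measurableSet]
        filter_upwards [hu0] with x hx hxΩ
        exact mul_nonneg (Real.rpow_nonneg (hx hxΩ) _) (hφ0 x)
      · exact hVΩ.eventuallyLE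
    have hlim : Tendsto (fun T : ℝ => C' * T ^ (-β)) atTop (𝓝 (C' * 0)) :=
      (tendsto_rpow_neg_atTop hβ0).const_mul C'
    rw [mul_zero] at hlim
    have hle0 : ∫ x in V, u x ^ p * φi x ≤ 0 :=
      ge_of_tendsto hlim ((eventually_ge_atTop T0).mono hle)
    have hnn : 0 ≤ᵐ[volume.restrict V] fun x => u x ^ p * φi x := by
      rw [Filter.EventuallyLE, ae_restrict_iff' hVo.measurableSet]
      filter_upwards [hu0] with x hx hxV
      exact mul_nonneg (Real.rpow_nonneg (hx (hVΩ hxV)) _) (hφi x (hVt x hxV).1 (hVt x hxV).2.2).le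
    have hz := (integral_eq_zero_iff_of_nonneg_ae hnn hiV).1 (le_antisymm hle0 (integral_nonneg_of_ae hnn))
    rw [Filter.EventuallyEq, ae_restrict_iff' hVo.measurableSet] at hz
    filter_upwards [hz, hu0] with x hx hxu hxV
    have h1 := hx hxV
    have h2 := hφi x (hVt x hxV).1 (hVt x hxV).2.2
    simp only [Pi.zero_apply, mul_eq_zero, h2.ne', or_false] at h1
    exact ((Real.rpow_eq_zero_iff_of_nonneg (hxu (hVΩ hxV))).1 h1).1


lemma glue_deriv1 (x : ℝ) : HasDerivAt expNegInvGlue ((x⁻¹) ^ 2 * expNegInvGlue x) x := by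
  have := expNegInvGlue.hasDerivAt_polynomial_eval_inv_mul (1 : Polynomial ℝ) x
  simpa using this

lemma glue_deriv2 (x : ℝ) : HasDerivAt (fun x => (x⁻¹) ^ 2 * expNegInvGlue x)
    ((x⁻¹) ^ 2 * ((x⁻¹) ^ 2 - 2 * x⁻¹) * expNegInvGlue x) x := by
  have := expNegInvGlue.hasDerivAt_polynomial_eval_inv_mul ((Polynomial.X : Polynomial ℝ) ^ 2) x
  simpa [one_add_one_eq_two] using this

lemma barrier {N : ℕ} (hN : 1 ≤ N) (x0 : Euc N) (ρ0 ρ : ℝ) (h0 : 0 < ρ0) (h1 : 0 < ρ) :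
    ∃ φ : Euc N → ℝ, ContDiff ℝ (⊤ : ℕ∞) φ ∧ (∀ x, 0 ≤ φ x) ∧ (∀ x ∈ ball x0 ρ, 0 < φ x) ∧
      (∀ x, x ∉ ball x0 ρ → φ x = 0) ∧ ∀ x, ρ0 ≤ ‖x - x0‖ → 0 ≤ lap φ x := by
  have hN' : (1 : ℝ) ≤ N := by exact_mod_cast hN
  set l : ℝ := N / (2 * ρ0 ^ 2) with hl
  have hl0 : 0 < l := by positivity
  set m := Real.exp (-l * ρ ^ 2) with hm
  have hm0 : 0 < m := Real.exp_pos _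
  set w : ℝ → ℝ := fun t => 1 / 2 * (Real.exp (-l * t) - m) with hw
  have hwd : ∀ t, HasDerivAt w (-(l / 2) * Real.exp (-l * t)) t := by
    intro t
    have h1 : HasDerivAt (fun t => Real.exp (-l * t)) (Real.exp (-l * t) * (-l * 1)) t :=
        ((hasDerivAt_id t).const_mul (-l)).exp
    refine ((h1.sub_const m).const_mul (1 / 2)).congr_deriv ?_
    ring
  have hwdd : ∀ t, HasDerivAt (fun t => -(l / 2) * Real.exp (-l * t)) (l ^ 2 / 2 * Real.exp (-l * t)) t := by
    intro t
    have h1 : HasDerivAt (fun t => Real.exp (-l * t)) (Real.exp (-l * t) * (-l * 1)) t :=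
        ((hasDerivAt_id t).const_mul (-l)).exp
    refine (h1.const_mul (-(l / 2))).congr_deriv ?_
    ring
  set E1 : ℝ → ℝ := fun x => (x⁻¹) ^ 2 * expNegInvGlue x with hE1
  set E2 : ℝ → ℝ := fun x => (x⁻¹) ^ 2 * ((x⁻¹) ^ 2 - 2 * x⁻¹) * expNegInvGlue x with hE2
  have hG : ∀ t, HasDerivAt (fun t => expNegInvGlue (w t)) (E1 (w t) * (-(l / 2) * Real.exp (-l * t))) t :=
    fun t => (glue_deriv1 (w t)).comp t (hwd t)
  have hG1 : ∀ t, HasDerivAt (fun t => E1 (w t) * (-(l / 2) * Real.exp (-l * t)))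
      (E2 (w t) * (-(l / 2) * Real.exp (-l * t)) * (-(l / 2) * Real.exp (-l * t))
        + E1 (w t) * (l ^ 2 / 2 * Real.exp (-l * t))) t :=
    fun t => (HasDerivAt.comp (h₂ := E1) t (glue_deriv2 (w t)) (hwd t)).mul (hwdd t)
  have hns : ∀ y, HasFDerivAt (fun y : Euc N => ‖y - x0‖ ^ 2) ((2:ℝ) • innerSL ℝ (y - x0)) y := by
    intro y
    have := HasFDerivAt.comp (g := fun y : Euc N => ‖y‖ ^ 2) y (hasFDerivAt_normsq (y - x0))
      ((hasFDerivAt_id y).sub_const x0)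
    exact this
  have hwpos : ∀ x : Euc N, 0 < w (‖x - x0‖ ^ 2) ↔ x ∈ ball x0 ρ := by
    intro x
    rw [mem_ball, dist_eq_norm, hw]
    simp only
    have : 0 < 1 / 2 * (Real.exp (-l * ‖x - x0‖ ^ 2) - m) ↔ -l * ρ ^ 2 < -l * ‖x - x0‖ ^ 2 := by
      rw [← Real.exp_lt_exp (x := -l * ρ ^ 2), ← hm]; constructor <;> intro h <;> linarith
    rw [this]
    constructor
    · intro h
      have h2 : ‖x - x0‖ ^ 2 < ρ ^ 2 := by
        by_contra hh
        have := mul_le_mul_of_nonneg_left (not_lt.1 hh) hl0.le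
        linarith
      exact lt_of_pow_lt_pow_left₀ 2 h1.le h2
    · intro h
      have h2 : ‖x - x0‖ ^ 2 < ρ ^ 2 := by gcongr
      have := mul_lt_mul_of_pos_left h2 hl0
      linarith
  refine ⟨fun x => expNegInvGlue (w (‖x - x0‖ ^ 2)), ?_, ?_, ?_, ?_, ?_⟩
  · have hwc : ContDiff ℝ (⊤ : ℕ∞) w := by simp only [hw]; fun_prop
    exact expNegInvGlue.contDiff.comp (hwc.comp ((contDiff_id.sub contDiff_const).norm_sq ℝ))
  · intro x; exact expNegInvGlue.nonneg _
  · intro x hx; exact expNegInvGlue.pos_of_pos ((hwpos x).2 hx)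
  · intro x hx; exact expNegInvGlue.zero_of_nonpos (not_lt.1 (fun h => hx ((hwpos x).1 h)))
  · intro x hx
    have key := lap_of_form (fun x => expNegInvGlue (w (‖x - x0‖ ^ 2)))
      (fun x => 2 * (E1 (w (‖x - x0‖ ^ 2)) * (-(l / 2) * Real.exp (-l * ‖x - x0‖ ^ 2)))) (fun _ => 0) x x0 0
      (4 * (E2 (w (‖x - x0‖ ^ 2)) * (-(l / 2) * Real.exp (-l * ‖x - x0‖ ^ 2)) * (-(l / 2) * Real.exp (-l * ‖x - x0‖ ^ 2))
        + E1 (w (‖x - x0‖ ^ 2)) * (l ^ 2 / 2 * Real.exp (-l * ‖x - x0‖ ^ 2)))) 0 0 0 ?_ ?_ ?_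
    rotate_left
    · refine Eventually.of_forall fun y => ?_
      refine ((hG _).comp_hasFDerivAt y (hns y)).congr_fderiv ?_
      rw [smul_smul, zero_smul, add_zero]; congr 1; ring
    · refine (((hG1 _).comp_hasFDerivAt x (hns x)).const_mul 2).congr_fderiv ?_
      rw [smul_smul, smul_smul, zero_smul, add_zero]; congr 1; ring
    · refine (hasFDerivAt_const (0:ℝ) x).congr_fderiv ?_
      simp
    rw [key]
    set t := ‖x - x0‖ ^ 2 with ht
    set X := Real.exp (-l * t) with hX
    have hX0 : 0 < X := Real.exp_pos _
    have hX1 : X ≤ 1 := by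
      rw [hX, Real.exp_le_one_iff]
      have : 0 ≤ l * t := by positivity
      linarith
    have hlt : (N : ℝ) / 2 ≤ l * t := by
      have : ρ0 ^ 2 ≤ t := by rw [ht]; gcongr
      calc (N : ℝ) / 2 = l * ρ0 ^ 2 := by rw [hl]; field_simp
        _ ≤ _ := by gcongr
    have hw2 : w t ≤ 1 / 2 := by simp only [hw]; linarith
    have hE1p : 0 ≤ E1 (w t) := mul_nonneg (by positivity) (expNegInvGlue.nonneg _)
    have hE2p : 0 ≤ E2 (w t) := by
      rcases le_or_gt (w t) 0 with h | h
      · simp only [hE2]; rw [expNegInvGlue.zero_of_nonpos h, mul_zero]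
      · simp only [hE2]
        have h2 : 2 ≤ (w t)⁻¹ := by
          rw [le_inv_comm₀ (by norm_num) h]; linarith
        refine mul_nonneg (mul_nonneg (by positivity) ?_) (expNegInvGlue.nonneg _)
        nlinarith
    have ht0 : 0 ≤ t := by positivity
    have e1 : 0 ≤ E2 (w t) * (l ^ 2 * X ^ 2 * t) := by positivity
    have e2 : 0 ≤ E1 (w t) * (2 * l * X) * (l * t - N / 2) := by
      apply mul_nonneg (by positivity); linarith
    have : (0 : ℝ) ≤ E2 (w t) * (l ^ 2 * X ^ 2 * t) + E1 (w t) * (2 * l * X) * (l * t - N / 2) := add_nonneg e1 e2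
    refine this.trans (le_of_eq ?_)
    simp
    ring

lemma propagate {N : ℕ} (hN : 1 ≤ N) (Ω : Set (Euc N)) (hΩo : IsOpen Ω) (c p : ℝ) (hc : 0 ≤ c) (hp : 0 < p)
    (u : Euc N → ℝ)
    (hu0 : ∀ᵐ x ∂volume, x ∈ Ω → 0 ≤ u x)
    (huloc : LocallyIntegrableOn u (Ω) volume)
    (hup : LocallyIntegrableOn (fun x => u x ^ p) (Ω) volume)
    (hbu : LocallyIntegrableOn (fun x => c * ‖x‖ ^ (-2 : ℝ) * u x) (Ω) volume)
    (hsuper : ∀ φ : Euc N → ℝ, IsTestFun (Ω) φ → (∀ x, 0 ≤ φ x) →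
      ∫ x in Ω, u x ^ p * φ x ≤
        ∫ x in Ω, u x * (-(lap φ x) - c * ‖x‖ ^ (-2 : ℝ) * φ x))
    (x0 : Euc N) (ρ0 ρ : ℝ) (h0 : 0 < ρ0) (h1 : 0 < ρ) (hball : closedBall x0 ρ ⊆ Ω)
    (hz : ∀ᵐ x ∂volume, x ∈ ball x0 ρ0 → u x = 0) : ∀ᵐ x ∂volume, x ∈ ball x0 ρ → u x = 0 := by
  obtain ⟨φ, hφs, hφ0, hφp, hφz, hφl⟩ := barrier hN x0 ρ0 ρ h0 h1
  have hsupp : tsupport φ ⊆ closedBall x0 ρ := by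
    apply closure_minimal _ isClosed_closedBall
    intro x hx
    by_contra h
    exact hx (hφz x (fun hh => h (ball_subset_closedBall hh)))
  have htf : IsTestFun Ω φ := ⟨hφs, (isCompact_closedBall x0 ρ).of_isClosed_subset (isClosed_tsupport φ) hsupp,
    hsupp.trans hball⟩
  obtain ⟨i1, i2⟩ := super_ineq c p u φ (fun _ => 0) hΩo hu0 huloc hup hbu htf hφ0 (hsuper φ htf hφ0)
    (integrable_zero _ _ _) (by
      filter_upwards [hz] with x hx hxΩ hux
      have hpos : 0 ≤ 1 / 2 * u x ^ p * φ x :=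
        mul_nonneg (mul_nonneg (by norm_num) (Real.rpow_nonneg hux _)) (hφ0 x)
      rw [add_zero]
      refine le_trans ?_ hpos
      by_cases h : x ∈ ball x0 ρ0
      · rw [hx h, zero_mul]
      · rw [mem_ball, dist_eq_norm, not_lt] at h
        have h2 := hφl x h
        have h3 : 0 ≤ c * (‖x‖ ^ 2)⁻¹ * φ x := mul_nonneg (by positivity) (hφ0 x)
        exact mul_nonpos_of_nonneg_of_nonpos hux (by linarith))
  simp only [integral_zero, mul_zero] at i2
  have hnn : 0 ≤ᵐ[volume.restrict Ω] fun x => u x ^ p * φ x := by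
    rw [Filter.EventuallyLE, ae_restrict_iff' hΩo.measurableSet]
    filter_upwards [hu0] with x hx hxV
    exact mul_nonneg (Real.rpow_nonneg (hx hxV) _) (hφ0 x)
  have hz' := (integral_eq_zero_iff_of_nonneg_ae hnn i1).1 (le_antisymm i2 (integral_nonneg_of_ae hnn))
  rw [Filter.EventuallyEq, ae_restrict_iff' hΩo.measurableSet] at hz'
  filter_upwards [hz', hu0] with x hx hxu hxV
  have hxΩ := hball (ball_subset_closedBall hxV)
  have h1 := hx hxΩ
  simp only [Pi.zero_apply, mul_eq_zero, (hφp x hxV).ne', or_false] at h1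
  exact ((Real.rpow_eq_zero_iff_of_nonneg (hxu hxΩ)).1 h1).1


/-- **Corollary 0.3.** Nonexistence of nontrivial nonnegative distributional supersolutions of
`-Δu - c|x|⁻²u ≥ uᵖ` on a smooth domain `Ω` with `0 ∈ ∂Ω`, when `N - 1 < c ≤ μ(Ω)` and
`p ≥ p_{S₊^{N-1}}`. -/
theorem nonexistence_smooth_global {N : ℕ} (hN : 3 ≤ N) (Ω : Set (Euc N))
    (hΩ : IsSmoothDomain Ω) (h0 : (0 : Euc N) ∈ frontier Ω)
    (c p : ℝ) (hc1 : (N : ℝ) - 1 < c) (hc2 : c ≤ hardyConst Ω)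
    (hp : 1 + 2 / (((N : ℝ) - 2) / 2 - Real.sqrt ((N : ℝ) ^ 2 / 4 - c)) ≤ p)
    (u : Euc N → ℝ)
    (hu0 : ∀ᵐ x ∂volume, x ∈ Ω → 0 ≤ u x)
    (huloc : LocallyIntegrableOn u (Ω) volume)
    (hup : LocallyIntegrableOn (fun x => u x ^ p) (Ω) volume)
    (hbu : LocallyIntegrableOn (fun x => c * ‖x‖ ^ (-2 : ℝ) * u x) (Ω) volume)
    (hsuper : ∀ φ : Euc N → ℝ, IsTestFun (Ω) φ → (∀ x, 0 ≤ φ x) →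
      ∫ x in Ω, u x ^ p * φ x ≤
        ∫ x in Ω, u x * (-(lap φ x) - c * ‖x‖ ^ (-2 : ℝ) * φ x)) :
    ∀ᵐ x ∂volume, x ∈ Ω → u x = 0 := by
  have hN' : (3 : ℝ) ≤ N := by exact_mod_cast hN
  have hc0 : 0 ≤ c := by linarith
  obtain ⟨-, -, -, -, hp1, -⟩ := params N hN c p hc1 hp
  obtain ⟨V, hVo, ⟨y0, hy0⟩, hVΩ, hV⟩ := initial_zero hN Ω hΩ h0 c p hc1 hp u hu0 huloc hup hbu hsuper
  have hΩo := hΩ.1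
  have hprop := propagate (by omega) Ω hΩo c p hc0 (by linarith) u hu0 huloc hup hbu hsuper
  set W : Set (Euc N) := {x | ∃ r > 0, ∀ᵐ y ∂volume, y ∈ ball x r → u y = 0} with hW
  have hWo : IsOpen W := by
    rw [Metric.isOpen_iff]
    rintro x ⟨r, hr, hx⟩
    refine ⟨r / 2, by linarith, fun y hy => ⟨r / 2, by linarith, ?_⟩⟩
    filter_upwards [hx] with z hz hzy
    apply hz
    rw [mem_ball] at hy hzy ⊢
    linarith [dist_triangle z y x]
  have hsub : Ω ⊆ W := by
    apply hΩ.2.2.1.isPreconnected.subset_of_closure_inter_subset hWo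
    · refine ⟨y0, hVΩ hy0, ?_⟩
      obtain ⟨r, hr, hrV⟩ := Metric.isOpen_iff.1 hVo y0 hy0
      refine ⟨r, hr, ?_⟩
      filter_upwards [hV] with z hz hzr using hz (hrV hzr)
    · rintro x ⟨hxc, hxΩ⟩
      obtain ⟨r, hr, hrΩ⟩ := Metric.isOpen_iff.1 hΩo x hxΩ
      obtain ⟨y, ⟨ρ0, hρ0, hy⟩, hxy⟩ := Metric.mem_closure_iff.1 hxc (r / 4) (by linarith)
      have hcb : closedBall y (r / 2) ⊆ Ω := by
        intro z hz
        apply hrΩ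
        rw [mem_closedBall] at hz
        rw [mem_ball]
        have := dist_triangle z y x
        rw [dist_comm y x] at this
        linarith
      have := hprop y ρ0 (r / 2) hρ0 (by linarith) hcb hy
      refine ⟨r / 4, by linarith, ?_⟩
      filter_upwards [this] with z hz hzx
      apply hz
      rw [mem_ball] at hzx ⊢
      linarith [dist_triangle z x y]
  have hnull : volume {x | x ∈ Ω ∧ u x ≠ 0} = 0 := by
    apply measure_null_of_locally_null
    rintro x ⟨hxΩ, -⟩
    obtain ⟨r, hr, hx⟩ := hsub hxΩ
    refine ⟨{y | y ∈ ball x r ∧ u y ≠ 0}, ?_, ?_⟩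
    · filter_upwards [mem_nhdsWithin_of_mem_nhds (ball_mem_nhds x hr), self_mem_nhdsWithin] with y h1 h2
      exact ⟨h1, h2.2⟩
    · rw [ae_iff] at hx
      convert hx using 3
      simp
  rw [ae_iff]
  convert hnull using 3
  simp
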